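/- Under Assumptions A1–A4 and the stated conditions on h and Γ, for every p̄ ∈ (0, p̌/(l₃ + 1)] there exists a constant C > 0, depending only on p̄, T, τ, r, ξ, L₀ and the constants in Assumptions A1–A4 (but not on Δ), such that for every admissible step size Δ ∈ (0,1]: E[ sup_{0 ≤ t ≤ T} |χ(t)|^{p̄} ] ≤ C, where χ is the continuous version of the truncated Euler–Maruyama scheme. -/

import Mathlib

open MeasureTheory ProbabilityTheory

lemma integrable_pow_gaussianReal (v : NNReal) (i : ℕ) :
    Integrable (fun z : ℝ => z ^ i) (gaussianReal 0 v) := by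
  have h := (memLp_id_gaussianReal (μ := 0) (v := v) (i : NNReal)).integrable_norm_pow'
  have h2 : Integrable (fun z : ℝ => ‖z ^ i‖) (gaussianReal 0 v) := by
    simpa [norm_pow] using h
  exact (integrable_norm_iff (by fun_prop)).1 h2

lemma integral_pow_gaussianReal {δ : ℝ} (hδ : 0 ≤ δ) (i : ℕ) :
    ∫ z, z ^ i ∂(gaussianReal 0 δ.toNNReal)
      = Real.sqrt δ ^ i * ∫ z, z ^ i ∂(gaussianReal 0 1) := by
  have h := gaussianReal_map_const_mul (μ := 0) (v := 1) (Real.sqrt δ)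
  have h2 : gaussianReal 0 δ.toNNReal
      = (gaussianReal 0 1).map (fun z => Real.sqrt δ * z) := by
    rw [h]
    congr 1
    · simp
    · ext
      simp [Real.sq_sqrt hδ, hδ]
  rw [h2, integral_map (by fun_prop) (by fun_prop), ← integral_const_mul]
  simp only [mul_pow]

lemma integral_odd_pow_gaussianReal (v : NNReal) {i : ℕ} (hi : Odd i) :
    ∫ z, z ^ i ∂(gaussianReal 0 v) = 0 := by
  have h := gaussianReal_map_neg (μ := 0) (v := v)
  rw [neg_zero] at h
  have h2 : ∫ z, z ^ i ∂(gaussianReal 0 v) = - ∫ z, z ^ i ∂(gaussianReal 0 v) := by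
    conv_lhs => rw [← h, integral_map (by fun_prop) (by fun_prop)]
    simp only [hi.neg_pow, integral_neg]
  linarith

lemma integral_sq_gaussianReal_one : ∫ z, z ^ 2 ∂(gaussianReal 0 1) = (1 : ℝ) := by
  have h := variance_fun_id_gaussianReal (μ := 0) (v := 1)
  rw [variance_of_integral_eq_zero (by fun_prop) (by simp [integral_id_gaussianReal])] at h
  simpa using h

lemma pow_add_mul_pow_le_add_pow {A B : ℝ} (hA : 0 ≤ A) (hB : 0 ≤ B) (m : ℕ) :
    A ^ (m + 1) + (m + 1) * A ^ m * B ≤ (A + B) ^ (m + 1) := by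
  induction m with
  | zero => simp
  | succ m ih =>
    have h0 : 0 ≤ A ^ m := by positivity
    have h1 := mul_le_mul_of_nonneg_right ih (add_nonneg hA hB)
    have h2 : 0 ≤ ((m : ℝ) + 1) * A ^ m * B * B := by positivity
    push_cast
    calc _ ≤ (A ^ (m + 1) + (m + 1) * A ^ m * B) * (A + B) := by
          ring_nf at h2 ⊢; nlinarith
      _ ≤ _ := by rw [pow_succ (A + B) (m + 1)]; exact h1

lemma add_mul_pow_le {x S c δ : ℝ} (hx : 0 ≤ x) (hxS : x ≤ S) (hc : 0 ≤ c) (hδ : 0 ≤ δ)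
    (hδ1 : δ ≤ 1) (m : ℕ) : (x + δ * (c * S)) ^ m ≤ x ^ m + δ * ((1 + c) ^ m * S ^ m) := by
  have hS : 0 ≤ S := hx.trans hxS
  have h := (convexOn_pow (𝕜 := ℝ) m).2 (show x ∈ Set.Ici 0 from hx)
    (show x + c * S ∈ Set.Ici 0 from by simp only [Set.mem_Ici]; positivity)
    (by linarith : 0 ≤ 1 - δ) hδ (by ring)
  simp only [smul_eq_mul] at h
  have e : (1 - δ) * x + δ * (x + c * S) = x + δ * (c * S) := by ring
  rw [e] at h
  have h1 : (x + c * S) ^ m ≤ (1 + c) ^ m * S ^ m := by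
    rw [← mul_pow]
    gcongr
    linarith
  have h2 : 0 ≤ δ * x ^ m := by positivity
  nlinarith [mul_le_mul_of_nonneg_left h1 hδ]

/-- The constant controlling the higher-order terms of a Gaussian increment. -/
noncomputable def gaussianRemainder (m : ℕ) (L : ℝ) : ℝ :=
  ∑ i ∈ Finset.range (2 * m + 1),
    ((2 * m).choose i : ℝ) * |∫ z, z ^ i ∂(gaussianReal 0 1)| * (1 + L) ^ i

lemma gaussianRemainder_nonneg (m : ℕ) {L : ℝ} (hL : 0 ≤ L) : 0 ≤ gaussianRemainder m L := by
  unfold gaussianRemainder; positivity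

lemma abs_pow_le_one_add_pow (y : ℝ) {k n : ℕ} (h : k ≤ 2 * n) :
    |y| ^ k ≤ 1 + y ^ (2 * n) := by
  have e : y ^ (2 * n) = |y| ^ (2 * n) := by rw [pow_mul, pow_mul, sq_abs]
  rw [e]
  rcases le_total |y| 1 with h1 | h1
  · have := pow_le_one₀ (n := k) (abs_nonneg y) h1
    have : 0 ≤ |y| ^ (2 * n) := by positivity
    linarith
  · have := pow_le_pow_right₀ h1 h
    linarith

lemma even_moment_coeff_le {b δ L : ℝ} (hδ : 0 ≤ δ) (hδ1 : δ ≤ 1) (hL : 0 ≤ L)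
    (hb : b ^ 4 * δ ≤ L) (j : ℕ) :
    (|b| * Real.sqrt δ) ^ (2 * (j + 2)) ≤ (1 + L) ^ (2 * (j + 2)) * δ := by
  have e : (|b| * Real.sqrt δ) ^ 2 = b ^ 2 * δ := by
    rw [mul_pow, sq_abs, Real.sq_sqrt hδ]
  have h4 : (b ^ 2 * δ) ^ 2 ≤ L * δ := by nlinarith
  have h2 : b ^ 2 * δ ≤ 1 + L := by
    have : L * δ ≤ L := by nlinarith
    nlinarith [sq_nonneg (b ^ 2 * δ - 1)]
  have h2' : (b ^ 2 * δ) ^ j ≤ (1 + L) ^ j := by gcongr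
  rw [pow_mul, e, pow_add]
  calc (b ^ 2 * δ) ^ j * (b ^ 2 * δ) ^ 2 ≤ (1 + L) ^ j * (L * δ) := by gcongr
    _ ≤ (1 + L) ^ j * ((1 + L) ^ (j + 4) * δ) := by
        gcongr
        calc L ≤ (1 + L) ^ 1 := by linarith
          _ ≤ (1 + L) ^ (j + 4) := pow_le_pow_right₀ (by linarith) (by omega)
    _ = _ := by ring

lemma gaussian_poly_le (m : ℕ) (hm : 1 ≤ m) {L b y δ : ℝ} (hL : 0 ≤ L) (hδ : 0 ≤ δ)
    (hδ1 : δ ≤ 1) (hb : b ^ 4 * δ ≤ L) :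
    ∑ i ∈ Finset.range (2 * m + 1), b ^ i * y ^ (2 * m - i) * ((2 * m).choose i : ℝ)
        * (∫ z, z ^ i ∂(gaussianReal 0 δ.toNNReal))
      ≤ (y ^ 2 + (2 * m - 1) * b ^ 2 * δ) ^ m
        + gaussianRemainder m L * δ * (1 + y ^ (2 * m)) := by
  obtain ⟨n, rfl⟩ : ∃ n, m = n + 1 := ⟨m - 1, by omega⟩
  set m := n + 1 with hmdef
  have key : ∀ i ∈ Finset.range (2 * m + 1),
      b ^ i * y ^ (2 * m - i) * ((2 * m).choose i : ℝ)
        * (∫ z, z ^ i ∂(gaussianReal 0 δ.toNNReal))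
      ≤ ((if i = 0 then y ^ (2 * m) else 0)
        + (if i = 2 then m * (2 * m - 1) * y ^ (2 * m - 2) * b ^ 2 * δ else 0))
        + ((2 * m).choose i : ℝ) * |∫ z, z ^ i ∂(gaussianReal 0 1)| * (1 + L) ^ i
          * (δ * (1 + y ^ (2 * m))) := by
    intro i hi
    have hi' : i ≤ 2 * m := by simpa [Nat.lt_succ_iff] using hi
    have hyn : 0 ≤ y ^ (2 * m) := by rw [pow_mul]; positivity
    have hrem : 0 ≤ ((2 * m).choose i : ℝ) * |∫ z, z ^ i ∂(gaussianReal 0 1)| * (1 + L) ^ i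
          * (δ * (1 + y ^ (2 * m))) := by positivity
    rcases Nat.even_or_odd i with he | ho
    · obtain ⟨j, hj⟩ := he
      rcases j with _ | _ | j
      · obtain rfl : i = 0 := by omega
        simp at hrem ⊢
        linarith
      · obtain rfl : i = 2 := by omega
        rw [integral_pow_gaussianReal hδ, integral_sq_gaussianReal_one, Real.sq_sqrt hδ]
        have hch : ((2 * m).choose 2 : ℝ) = m * (2 * m - 1) := by
          rw [Nat.cast_choose_two]; push_cast; ring
        rw [integral_sq_gaussianReal_one] at hrem
        rw [hch] at hrem ⊢
        simp only [if_true, OfNat.ofNat_ne_zero, if_false]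
        linarith
      · obtain rfl : i = 2 * (j + 2) := by omega
        rw [if_neg (by omega), if_neg (by omega), integral_pow_gaussianReal hδ]
        simp only [zero_add]
        set c := ∫ z, z ^ (2 * (j + 2)) ∂(gaussianReal 0 1) with hc
        calc b ^ (2 * (j + 2)) * y ^ (2 * m - 2 * (j + 2)) * ((2 * m).choose (2 * (j + 2)) : ℝ)
              * (Real.sqrt δ ^ (2 * (j + 2)) * c)
            ≤ |b ^ (2 * (j + 2)) * y ^ (2 * m - 2 * (j + 2))
              * ((2 * m).choose (2 * (j + 2)) : ℝ) * (Real.sqrt δ ^ (2 * (j + 2)) * c)| :=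
              le_abs_self _
          _ = ((2 * m).choose (2 * (j + 2)) : ℝ) * |c| * (|b| * Real.sqrt δ) ^ (2 * (j + 2))
              * |y| ^ (2 * m - 2 * (j + 2)) := by
              rw [abs_mul, abs_mul, abs_mul, abs_mul, abs_pow, abs_pow, abs_pow, Nat.abs_cast,
                abs_of_nonneg (Real.sqrt_nonneg δ)]
              ring
          _ ≤ ((2 * m).choose (2 * (j + 2)) : ℝ) * |c| * ((1 + L) ^ (2 * (j + 2)) * δ)
              * (1 + y ^ (2 * m)) := by
              gcongr
              · exact even_moment_coeff_le hδ hδ1 hL hb j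
              · exact abs_pow_le_one_add_pow y (by omega)
          _ = _ := by ring
    · rw [integral_odd_pow_gaussianReal _ ho, mul_zero, if_neg (by rintro rfl; simp at ho),
        if_neg (by rintro rfl; exact absurd ho (by decide))]
      linarith
  refine (Finset.sum_le_sum key).trans ?_
  rw [Finset.sum_add_distrib, Finset.sum_add_distrib, Finset.sum_ite_eq', Finset.sum_ite_eq',
    if_pos (by simp), if_pos (by simp; omega), ← Finset.sum_mul]
  have h1 := pow_add_mul_pow_le_add_pow (A := y ^ 2) (B := (2 * m - 1) * b ^ 2 * δ) (by positivity)
    (by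
      have : (0 : ℝ) ≤ 2 * m - 1 := by rw [hmdef]; push_cast; linarith [n.cast_nonneg (α := ℝ)]
      positivity) n
  have e1 : y ^ (2 * m - 2) = (y ^ 2) ^ n := by rw [← pow_mul]; congr 1
  rw [pow_mul, e1]
  have e2 : (m : ℝ) = n + 1 := by rw [hmdef]; push_cast; ring
  rw [← hmdef] at h1
  unfold gaussianRemainder
  rw [← e2] at h1
  linarith

lemma integral_add_mul_gaussian_pow_le {Ω : Type*} {𝓕 : MeasurableSpace Ω}
    [mΩ : MeasurableSpace Ω] (μ : Measure Ω)
    [IsProbabilityMeasure μ] (m : ℕ) (hm : 1 ≤ m) {L δ : ℝ} (hL : 0 ≤ L) (hδ : 0 ≤ δ)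
    (hδ1 : δ ≤ 1) (h𝓕 : 𝓕 ≤ mΩ) {y b Z : Ω → ℝ}
    (hy : Measurable[𝓕] y) (hb : Measurable[𝓕] b) (hZ : Measurable Z)
    (hlaw : μ.map Z = gaussianReal 0 δ.toNNReal)
    (hind : Indep 𝓕 (MeasurableSpace.comap Z inferInstance) μ)
    {K K' : ℝ} (hyK : ∀ ω, |y ω| ≤ K) (hbK : ∀ ω, |b ω| ≤ K')
    (hbL : ∀ ω, b ω ^ 4 * δ ≤ L) :
    Integrable (fun ω => (y ω + b ω * Z ω) ^ (2 * m)) μ ∧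
    ∫ ω, (y ω + b ω * Z ω) ^ (2 * m) ∂μ
      ≤ ∫ ω, ((y ω ^ 2 + (2 * m - 1) * b ω ^ 2 * δ) ^ m
        + gaussianRemainder m L * δ * (1 + y ω ^ (2 * m))) ∂μ := by
  have hy' : Measurable y := hy.mono h𝓕 le_rfl
  have hb' : Measurable b := hb.mono h𝓕 le_rfl
  have hZi : ∀ i : ℕ, Integrable (fun ω => Z ω ^ i) μ := by
    intro i
    have := integrable_pow_gaussianReal δ.toNNReal i
    rw [← hlaw] at this
    exact (integrable_map_measure (continuous_pow i).aestronglyMeasurable hZ.aemeasurable).1 this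
  have hZint : ∀ i : ℕ, ∫ ω, Z ω ^ i ∂μ = ∫ z, z ^ i ∂(gaussianReal 0 δ.toNNReal) := by
    intro i
    rw [← hlaw, integral_map (by fun_prop) (by fun_prop)]
  let f : ℕ → Ω → ℝ := fun i ω => b ω ^ i * y ω ^ (2 * m - i) * ((2 * m).choose i : ℝ)
  have hfm : ∀ i, Measurable[𝓕] (f i) := fun i => by fun_prop
  have hfb : ∀ i ω, ‖f i ω‖ ≤ K' ^ i * K ^ (2 * m - i) * ((2 * m).choose i : ℝ) := by
    intro i ω
    have hK : 0 ≤ K := (abs_nonneg _).trans (hyK ω)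
    have hK' : 0 ≤ K' := (abs_nonneg _).trans (hbK ω)
    simp only [f, Real.norm_eq_abs, abs_mul, abs_pow, Nat.abs_cast]
    gcongr
    · exact hbK ω
    · exact hyK ω
  have hfi : ∀ i, Integrable (f i) μ := fun i =>
    Integrable.of_bound ((hfm i).mono h𝓕 le_rfl).aestronglyMeasurable _
      (Filter.Eventually.of_forall (hfb i))
  have hindep : ∀ i : ℕ, IndepFun (f i) (fun ω => Z ω ^ i) μ := by
    intro i
    have h1 : IndepFun (f i) Z μ := by
      rw [IndepFun_iff_Indep]
      exact indep_of_indep_of_le_left hind (hfm i).comap_le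
    exact h1.comp measurable_id (by fun_prop : Measurable fun z : ℝ => z ^ i)
  have hexp : ∀ ω, (y ω + b ω * Z ω) ^ (2 * m)
      = ∑ i ∈ Finset.range (2 * m + 1), f i ω * Z ω ^ i := by
    intro ω
    rw [add_comm, add_pow]
    refine Finset.sum_congr rfl fun i _ => ?_
    simp only [f, mul_pow]; ring
  have hprod : ∀ i, Integrable (fun ω => f i ω * Z ω ^ i) μ := fun i =>
    (hindep i).integrable_mul (hfi i) (hZi i)
  refine ⟨?_, ?_⟩
  · simp_rw [hexp]
    exact integrable_finsetSum _ fun i _ => hprod i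
  simp_rw [hexp]
  rw [integral_finsetSum _ fun i _ => hprod i]
  have h1 : ∀ i, ∫ ω, f i ω * Z ω ^ i ∂μ
      = ∫ ω, f i ω * (∫ z, z ^ i ∂(gaussianReal 0 δ.toNNReal)) ∂μ := by
    intro i
    rw [(hindep i).integral_fun_mul_eq_mul_integral (hfi i).1 (hZi i).1, hZint]
    exact (integral_mul_const _ _).symm
  simp_rw [h1]
  rw [← integral_finsetSum _ fun i _ => (hfi i).mul_const _]
  refine integral_mono (integrable_finsetSum _ fun i _ => (hfi i).mul_const _) ?_
    fun ω => gaussian_poly_le m hm hL hδ hδ1 (hbL ω)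
  have hm1 : (0 : ℝ) ≤ 2 * m - 1 := by
    have : (1 : ℝ) ≤ m := by exact_mod_cast hm
    linarith
  refine Integrable.of_bound (by fun_prop)
    ((K ^ 2 + (2 * m - 1) * K' ^ 2 * δ) ^ m + gaussianRemainder m L * δ * (1 + K ^ (2 * m)))
    (Filter.Eventually.of_forall fun ω => ?_)
  have hG := gaussianRemainder_nonneg m hL
  have hy2 : y ω ^ 2 ≤ K ^ 2 := sq_le_sq' (by linarith [abs_le.1 (hyK ω)]) (abs_le.1 (hyK ω)).2
  have hb2 : b ω ^ 2 ≤ K' ^ 2 := sq_le_sq' (by linarith [abs_le.1 (hbK ω)]) (abs_le.1 (hbK ω)).2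
  rw [Real.norm_eq_abs, abs_of_nonneg (by rw [pow_mul]; positivity), pow_mul, pow_mul]
  gcongr

lemma add_sum_sq_pow_le {ι : Type*} [Fintype ι] (m : ℕ) {R : ℝ} (hR : 0 ≤ R) (f : ι → ℝ) :
    (R + ∑ l, f l ^ 2) ^ (m + 1)
      ≤ 2 ^ m * (1 + (Fintype.card ι : ℝ) ^ m) * (R ^ (m + 1) + ∑ l, f l ^ (2 * (m + 1))) := by
  have h1 := add_pow_le hR (Finset.sum_nonneg fun l (_ : l ∈ Finset.univ) => sq_nonneg (f l)) (m + 1)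
  have h2 : (∑ l, f l ^ 2) ^ (m + 1)
      ≤ (Fintype.card ι : ℝ) ^ m * ∑ l, f l ^ (2 * (m + 1)) := by
    rcases isEmpty_or_nonempty ι with he | hne
    · simp
    have h := pow_sum_div_card_le_sum_pow (s := Finset.univ) (f := fun l => f l ^ 2)
      (fun l _ => sq_nonneg (f l)) m
    have hcard : (0 : ℝ) < (Fintype.card ι : ℝ) ^ m := by
      have : 0 < Fintype.card ι := Fintype.card_pos
      positivity
    rw [Finset.card_univ, div_le_iff₀ hcard] at h
    simp only [pow_mul]
    linarith
  have h3 : 0 ≤ ∑ l, f l ^ (2 * (m + 1)) :=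
    Finset.sum_nonneg fun l _ => by rw [pow_mul]; positivity
  have h4 : 0 ≤ R ^ (m + 1) := by positivity
  have h5 : (0 : ℝ) ≤ (Fintype.card ι : ℝ) ^ m := by positivity
  refine h1.trans ?_
  rw [Nat.add_sub_cancel, mul_assoc]
  gcongr
  nlinarith [mul_nonneg h5 h4]

/-- The growth constant of one step of the stopped moment of order `2 * m`. -/
noncomputable def stepConstant (m : ℕ) (L c q : ℝ) : ℝ :=
  ((1 + c) ^ m + gaussianRemainder m L * (1 + (1 + c) ^ m)) * (2 ^ (m - 1) * (1 + q ^ (m - 1)))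
    + gaussianRemainder m L

lemma stepConstant_nonneg (m : ℕ) {L c q : ℝ} (hL : 0 ≤ L) (hc : 0 ≤ c) (hq : 0 ≤ q) :
    0 ≤ stepConstant m L c q := by
  have := gaussianRemainder_nonneg m hL
  unfold stepConstant; positivity

lemma drift_step_le {ι : Type*} [Fintype ι] (l₀ : ι) {m : ℕ} (hm : 1 ≤ m) {L c δ a b R : ℝ}
    (f : ι → ℝ) (hL : 0 ≤ L) (hc : 0 ≤ c) (hδ : 0 ≤ δ) (hδ1 : δ ≤ 1) (hR : 0 ≤ R)
    (h : 2 * f l₀ * a + (2 * m - 1) * b ^ 2 + a ^ 2 * δ ≤ c * (R + ∑ l, f l ^ 2)) :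
    ((f l₀ + a * δ) ^ 2 + (2 * m - 1) * b ^ 2 * δ) ^ m
        + gaussianRemainder m L * δ * (1 + (f l₀ + a * δ) ^ (2 * m))
      ≤ f l₀ ^ (2 * m)
        + δ * (stepConstant m L c (Fintype.card ι) * (1 + R ^ m + ∑ l, f l ^ (2 * m))) := by
  obtain ⟨n, rfl⟩ : ∃ n, m = n + 1 := ⟨m - 1, by omega⟩
  set S := R + ∑ l, f l ^ 2 with hS
  set G := gaussianRemainder (n + 1) L
  have hG : 0 ≤ G := gaussianRemainder_nonneg _ hL
  have hfS : f l₀ ^ 2 ≤ S := by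
    have := Finset.single_le_sum (fun l _ => sq_nonneg (f l)) (Finset.mem_univ l₀)
    linarith
  have hS0 : 0 ≤ S := (sq_nonneg _).trans hfS
  have hmm : (0 : ℝ) ≤ (2 * (n + 1 : ℕ) - 1) * b ^ 2 * δ := by
    have : (0 : ℝ) ≤ 2 * (n + 1 : ℕ) - 1 := by push_cast; linarith [n.cast_nonneg (α := ℝ)]
    positivity
  have h1 : (f l₀ + a * δ) ^ 2 + (2 * (n + 1 : ℕ) - 1) * b ^ 2 * δ ≤ f l₀ ^ 2 + δ * (c * S) := by
    nlinarith [mul_le_mul_of_nonneg_left h hδ]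
  have h2 := add_mul_pow_le (sq_nonneg (f l₀)) hfS hc hδ hδ1 (n + 1)
  have h3 : ((f l₀ + a * δ) ^ 2 + (2 * (n + 1 : ℕ) - 1) * b ^ 2 * δ) ^ (n + 1)
      ≤ f l₀ ^ (2 * (n + 1)) + δ * ((1 + c) ^ (n + 1) * S ^ (n + 1)) := by
    rw [pow_mul]
    exact (pow_le_pow_left₀ (by positivity) h1 _).trans h2
  have h4 : (f l₀ + a * δ) ^ (2 * (n + 1)) ≤ (1 + (1 + c) ^ (n + 1)) * S ^ (n + 1) := by
    have h5 : (f l₀ + a * δ) ^ (2 * (n + 1))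
        ≤ ((f l₀ + a * δ) ^ 2 + (2 * (n + 1 : ℕ) - 1) * b ^ 2 * δ) ^ (n + 1) := by
      rw [pow_mul]
      exact pow_le_pow_left₀ (sq_nonneg _) (by linarith) _
    have h6 : f l₀ ^ (2 * (n + 1)) ≤ S ^ (n + 1) := by
      rw [pow_mul]; exact pow_le_pow_left₀ (sq_nonneg _) hfS _
    have h7 : δ * ((1 + c) ^ (n + 1) * S ^ (n + 1)) ≤ (1 + c) ^ (n + 1) * S ^ (n + 1) :=
      mul_le_of_le_one_left (by positivity) hδ1
    linarith
  have h8 := add_sum_sq_pow_le n hR f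
  rw [← hS] at h8
  set Q := R ^ (n + 1) + ∑ l, f l ^ (2 * (n + 1)) with hQ
  have hQ0 : 0 ≤ Q := add_nonneg (by positivity)
    (Finset.sum_nonneg fun l _ => by rw [pow_mul]; positivity)
  set D := (1 + c) ^ (n + 1) with hD
  have hD0 : 0 ≤ D := by positivity
  set E := (2 : ℝ) ^ n * (1 + (Fintype.card ι : ℝ) ^ n) with hE
  have hE0 : 0 ≤ E := by positivity
  have h9 : stepConstant (n + 1) L c (Fintype.card ι) = (D + G * (1 + D)) * E + G := rfl
  rw [h9, add_assoc 1, ← hQ]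
  have h10 : G * δ * (1 + (f l₀ + a * δ) ^ (2 * (n + 1)))
      ≤ G * δ * (1 + (1 + D) * S ^ (n + 1)) := by gcongr
  have h11 : (D + G * (1 + D)) * S ^ (n + 1) ≤ (D + G * (1 + D)) * (E * Q) := by gcongr
  have h12 : (D + G * (1 + D)) * S ^ (n + 1) + G
      ≤ ((D + G * (1 + D)) * E + G) * (1 + Q) := by
    have : 0 ≤ (D + G * (1 + D)) * E := by positivity
    nlinarith [mul_nonneg hG hQ0]
  have h13 := mul_le_mul_of_nonneg_left h12 hδ
  nlinarith

lemma le_mul_one_add_pow_of_delayed_step {ι : Type*} [Fintype ι] {N : ℕ} {v : ℕ → ℝ}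
    {idx : ℕ → ι → ℕ} {K G₀ ρ : ℝ} (hK : 0 ≤ K) (hρ : 0 ≤ ρ) (hG₀ : 1 + ρ ≤ G₀) (hv0 : v 0 ≤ G₀)
    (hidx : ∀ n < N, ∀ l, idx n l ≤ n)
    (hstep : ∀ n < N, v (n + 1) ≤ v n + K * (1 + ρ + ∑ l, v (idx n l))) :
    ∀ n ≤ N, v n ≤ G₀ * (1 + K * (1 + Fintype.card ι)) ^ n := by
  intro n
  induction n using Nat.strong_induction_on with
  | _ n ih =>
    intro hn
    rcases n with _ | n
    · simpa using hv0
    have hx : (1 : ℝ) ≤ 1 + K * (1 + Fintype.card ι) := by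
      have : 0 ≤ K * (1 + (Fintype.card ι : ℝ)) := by positivity
      linarith
    set x := 1 + K * (1 + (Fintype.card ι : ℝ)) with hxdef
    have hG : 0 ≤ G₀ := by linarith
    have h1 : ∑ l, v (idx n l) ≤ ∑ _l : ι, G₀ * x ^ n := by
      refine Finset.sum_le_sum fun l _ => ?_
      have := hidx n (by omega) l
      refine (ih _ (by omega) (by omega)).trans ?_
      gcongr
    rw [Finset.sum_const, Finset.card_univ, nsmul_eq_mul] at h1
    have h2 : G₀ ≤ G₀ * x ^ n := le_mul_of_one_le_right hG (one_le_pow₀ hx)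
    have h3 := ih n (by omega) (by omega)
    calc v (n + 1) ≤ v n + K * (1 + ρ + ∑ l, v (idx n l)) := hstep n (by omega)
      _ ≤ G₀ * x ^ n + K * (G₀ * x ^ n + Fintype.card ι * (G₀ * x ^ n)) := by
          gcongr
          linarith
      _ = _ := by rw [pow_succ, hxdef]; ring

/-- An adapted recursion `Y (n+1) = Y n + a n * δ + b n * Z n` driven by independent centred
Gaussian variables of variance `δ`, whose coefficients satisfy a one-sided growth condition that
may involve finitely many earlier values of `Y` and a remainder `R` with bounded `m`-th moment. -/
structure IsDissipativeScheme {Ω : Type*} [mΩ : MeasurableSpace Ω] (μ : Measure Ω)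
    {ι : Type*} [Fintype ι] (l₀ : ι) (m N : ℕ) (L c ρ δ : ℝ) (𝓕 : ℕ → MeasurableSpace Ω)
    (Y a b Z R : ℕ → Ω → ℝ) (idx : ℕ → ι → ℕ) : Prop where
  le : ∀ n, 𝓕 n ≤ mΩ
  measurable_process : ∀ n ≤ N, ∀ j ≤ n, Measurable[𝓕 n] (Y j)
  measurable_drift : ∀ n < N, Measurable[𝓕 n] (a n)
  measurable_diffusion : ∀ n < N, Measurable[𝓕 n] (b n)
  measurable_noise : ∀ n < N, Measurable (Z n)
  law_noise : ∀ n < N, μ.map (Z n) = gaussianReal 0 δ.toNNReal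
  indep_noise : ∀ n < N, Indep (𝓕 n) (MeasurableSpace.comap (Z n) inferInstance) μ
  recursion : ∀ n < N, ∀ ω, Y (n + 1) ω = Y n ω + a n ω * δ + b n ω * Z n ω
  diffusion_bound : ∀ n < N, ∀ ω, b n ω ^ 4 * δ ≤ L
  drift_bound : ∃ κ, ∀ n < N, ∀ ω, a n ω ^ 2 ≤ κ * (1 + ∑ l, Y (idx n l) ω ^ 2)
  remainder_nonneg : ∀ n < N, ∀ ω, 0 ≤ R n ω
  remainder_integrable : ∀ n < N, Integrable (fun ω => R n ω ^ m) μ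
  remainder_moment : ∀ n < N, ∫ ω, R n ω ^ m ∂μ ≤ ρ
  idx_le : ∀ n < N, ∀ l, idx n l ≤ n
  idx_self : ∀ n < N, idx n l₀ = n
  growth : ∀ n < N, ∀ ω, 2 * Y n ω * a n ω + (2 * m - 1) * b n ω ^ 2 + a n ω ^ 2 * δ
    ≤ c * (R n ω + ∑ l, Y (idx n l) ω ^ 2)

/-- The event that `Y` has stayed below the level `lev` up to index `n`. -/
def staysBelow {Ω : Type*} (Y : ℕ → Ω → ℝ) (lev : ℝ) (n : ℕ) : Set Ω :=
  {ω | ∀ j ≤ n, |Y j ω| < lev}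

/-- The `k`-th power of `Y`, frozen at the value `lev ^ k` once `Y` has reached `lev`. -/
noncomputable def frozenPow {Ω : Type*} (Y : ℕ → Ω → ℝ) (lev : ℝ) (k n : ℕ) (ω : Ω) : ℝ :=
  open Classical in if ω ∈ staysBelow Y lev n then Y n ω ^ k else lev ^ k

lemma measurableSet_staysBelow {Ω : Type*} {𝓖 : MeasurableSpace Ω} {Y : ℕ → Ω → ℝ} {lev : ℝ}
    {n : ℕ} (hY : ∀ j ≤ n, Measurable[𝓖] (Y j)) : MeasurableSet[𝓖] (staysBelow Y lev n) := by
  have : staysBelow Y lev n = ⋂ j ∈ Finset.range (n + 1), {ω | |Y j ω| < lev} := by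
    ext ω
    simp [staysBelow]
  rw [this]
  refine Finset.measurableSet_biInter _ fun j hj => ?_
  have hYj := hY j (by simpa [Nat.lt_succ_iff] using hj)
  exact measurableSet_lt hYj.norm measurable_const

lemma frozenPow_nonneg {Ω : Type*} (Y : ℕ → Ω → ℝ) {lev : ℝ} (hlev : 0 < lev) (m n : ℕ) (ω : Ω) :
    0 ≤ frozenPow Y lev (2 * m) n ω := by
  unfold frozenPow
  split_ifs
  · rw [pow_mul]; positivity
  · positivity

lemma frozenPow_le {Ω : Type*} (Y : ℕ → Ω → ℝ) {lev : ℝ} (m n : ℕ) (ω : Ω) :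
    frozenPow Y lev (2 * m) n ω ≤ lev ^ (2 * m) := by
  unfold frozenPow
  split_ifs with h
  · have := h n le_rfl
    rw [pow_mul, ← sq_abs, ← pow_mul]
    exact pow_le_pow_left₀ (abs_nonneg _) this.le _
  · exact le_rfl

namespace IsDissipativeScheme

variable {Ω : Type*} [mΩ : MeasurableSpace Ω] {μ : Measure Ω}
    {ι : Type*} [Fintype ι] {l₀ : ι} {m N : ℕ} {L c ρ δ : ℝ} {𝓕 : ℕ → MeasurableSpace Ω}
    {Y a b Z R : ℕ → Ω → ℝ} {idx : ℕ → ι → ℕ}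

lemma measurable_frozenPow (h : IsDissipativeScheme μ l₀ m N L c ρ δ 𝓕 Y a b Z R idx)
    {n : ℕ} (hn : n ≤ N) (lev : ℝ) (k : ℕ) : Measurable (frozenPow Y lev k n) := by
  classical
  have hY : ∀ j ≤ n, Measurable (Y j) := fun j hj =>
    (h.measurable_process n hn j hj).mono (h.le n) le_rfl
  exact Measurable.ite (measurableSet_staysBelow hY) ((hY n le_rfl).pow_const k) measurable_const

variable [IsProbabilityMeasure μ]

lemma integrable_frozenPow (h : IsDissipativeScheme μ l₀ m N L c ρ δ 𝓕 Y a b Z R idx)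
    {n : ℕ} (hn : n ≤ N) {lev : ℝ} (hlev : 0 < lev) :
    Integrable (frozenPow Y lev (2 * m) n) μ := by
  refine Integrable.of_bound (h.measurable_frozenPow hn lev _).aestronglyMeasurable
    (lev ^ (2 * m)) (Filter.Eventually.of_forall fun ω => ?_)
  rw [Real.norm_eq_abs, abs_of_nonneg (frozenPow_nonneg Y hlev m n ω)]
  exact frozenPow_le Y m n ω

lemma integral_frozenPow_succ_le (h : IsDissipativeScheme μ l₀ m N L c ρ δ 𝓕 Y a b Z R idx)
    (hm : 1 ≤ m) (hL : 0 ≤ L) (hc : 0 ≤ c) (hδ : 0 < δ) (hδ1 : δ ≤ 1)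
    {n : ℕ} (hn : n < N) {lev : ℝ} (hlev : 0 < lev) :
    ∫ ω, frozenPow Y lev (2 * m) (n + 1) ω ∂μ ≤ ∫ ω, frozenPow Y lev (2 * m) n ω ∂μ
      + δ * stepConstant m L c (Fintype.card ι)
        * (1 + ρ + ∑ l, ∫ ω, frozenPow Y lev (2 * m) (idx n l) ω ∂μ) := by
  classical
  set A := staysBelow Y lev n with hA
  have hAm : MeasurableSet[𝓕 n] A := measurableSet_staysBelow (h.measurable_process n hn.le)
  have hAm' : MeasurableSet A := h.le n _ hAm
  set K := stepConstant m L c (Fintype.card ι) with hK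
  have hK0 : 0 ≤ K := stepConstant_nonneg m hL hc (Nat.cast_nonneg _)
  let y : Ω → ℝ := A.indicator fun ω => Y n ω + a n ω * δ
  let d : Ω → ℝ := A.indicator (b n)
  have hYn : Measurable[𝓕 n] (Y n) := h.measurable_process n hn.le n le_rfl
  have han : Measurable[𝓕 n] (a n) := h.measurable_drift n hn
  have hy : Measurable[𝓕 n] y := (hYn.add (han.mul_const δ)).indicator hAm
  have hd : Measurable[𝓕 n] d := (h.measurable_diffusion n hn).indicator hAm
  obtain ⟨κ, hκ⟩ := h.drift_bound
  have hyb : ∃ B, ∀ ω, |y ω| ≤ B := by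
    refine ⟨lev + (1 + |κ| * (1 + Fintype.card ι * lev ^ 2)) * δ, fun ω => ?_⟩
    by_cases hω : ω ∈ A
    · have ha := hκ n hn ω
      have hs : ∑ l, Y (idx n l) ω ^ 2 ≤ Fintype.card ι * lev ^ 2 := by
        calc ∑ l, Y (idx n l) ω ^ 2 ≤ ∑ _l : ι, lev ^ 2 := by
              refine Finset.sum_le_sum fun l _ => ?_
              have := hω _ (h.idx_le n hn l)
              rw [← sq_abs]
              exact pow_le_pow_left₀ (abs_nonneg _) this.le _
          _ = _ := by simp
      have hs0 : 0 ≤ ∑ l, Y (idx n l) ω ^ 2 := Finset.sum_nonneg fun l _ => sq_nonneg _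
      have ha2 : a n ω ^ 2 ≤ |κ| * (1 + Fintype.card ι * lev ^ 2) :=
        calc a n ω ^ 2 ≤ κ * (1 + ∑ l, Y (idx n l) ω ^ 2) := ha
          _ ≤ |κ| * (1 + ∑ l, Y (idx n l) ω ^ 2) := by gcongr; exact le_abs_self κ
          _ ≤ _ := by gcongr
      have ha3 : |a n ω| ≤ 1 + a n ω ^ 2 := by
        rw [← sq_abs]; nlinarith [sq_nonneg (|a n ω| - 1), abs_nonneg (a n ω)]
      simp only [y, Set.indicator_of_mem hω]
      calc |Y n ω + a n ω * δ| ≤ |Y n ω| + |a n ω| * δ := by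
            refine (abs_add_le _ _).trans ?_
            rw [abs_mul, abs_of_pos hδ]
        _ ≤ _ := by
            have := (hω n le_rfl).le
            gcongr
            linarith
    · simp only [y, Set.indicator_of_notMem hω, abs_zero]
      positivity
  have hdL : ∀ ω, d ω ^ 4 * δ ≤ L := fun ω => by
    by_cases hω : ω ∈ A
    · simpa only [d, Set.indicator_of_mem hω] using h.diffusion_bound n hn ω
    · simpa only [d, Set.indicator_of_notMem hω, ne_eq, OfNat.ofNat_ne_zero, not_false_eq_true,
        zero_pow, zero_mul] using hL
  have hdb : ∀ ω, |d ω| ≤ 1 + L / δ := fun ω => by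
    have h1 : d ω ^ 4 ≤ L / δ := by rw [le_div_iff₀ hδ]; exact hdL ω
    have h2 : |d ω| ≤ 1 + d ω ^ 4 := by
      simpa using abs_pow_le_one_add_pow (d ω) (k := 1) (n := 2) (by norm_num)
    linarith
  obtain ⟨B, hB⟩ := hyb
  obtain ⟨hint, hle⟩ := integral_add_mul_gaussian_pow_le μ m hm hL hδ.le hδ1 (h.le n) hy hd
    (h.measurable_noise n hn) (h.law_noise n hn) (h.indep_noise n hn) hB hdb hdL
  have hidxN : ∀ l, idx n l ≤ N := fun l => (h.idx_le n hn l).trans hn.le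
  have hm0 : m ≠ 0 := by omega
  have hind : Integrable (Aᶜ.indicator fun _ => lev ^ (2 * m)) μ :=
    (integrable_const _).indicator hAm'.compl
  have hfirst : ∀ ω, frozenPow Y lev (2 * m) (n + 1) ω
      ≤ (y ω + d ω * Z n ω) ^ (2 * m) + Aᶜ.indicator (fun _ => lev ^ (2 * m)) ω := by
    intro ω
    by_cases hω : ω ∈ A
    · have hω' : ω ∉ Aᶜ := fun h => h hω
      simp only [y, d, Set.indicator_of_mem hω, Set.indicator_of_notMem hω', add_zero]
      rw [← h.recursion n hn ω]
      unfold frozenPow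
      split_ifs with hs
      · exact le_rfl
      · have : lev ≤ |Y (n + 1) ω| := by
          by_contra hlt
          refine hs fun j hj => ?_
          rcases Nat.lt_or_ge n j with h1 | h1
          · obtain rfl : j = n + 1 := by omega
            exact not_le.1 hlt
          · exact hω j h1
        calc lev ^ (2 * m) ≤ |Y (n + 1) ω| ^ (2 * m) := pow_le_pow_left₀ hlev.le this _
          _ = _ := by rw [pow_mul, sq_abs, ← pow_mul]
    · have hω' : ω ∈ Aᶜ := hω
      simp only [y, d, Set.indicator_of_notMem hω, Set.indicator_of_mem hω']
      have := frozenPow_le Y (lev := lev) m (n + 1) ω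
      simpa [hm0] using this
  have hsum_nonneg : ∀ ω, 0 ≤ ∑ l, frozenPow Y lev (2 * m) (idx n l) ω := fun ω =>
    Finset.sum_nonneg fun l _ => frozenPow_nonneg Y hlev m _ ω
  have hsecond : ∀ ω, ((y ω ^ 2 + (2 * m - 1) * d ω ^ 2 * δ) ^ m
        + gaussianRemainder m L * δ * (1 + y ω ^ (2 * m)))
        + Aᶜ.indicator (fun _ => lev ^ (2 * m)) ω
      ≤ frozenPow Y lev (2 * m) n ω
        + δ * (K * (1 + R n ω ^ m + ∑ l, frozenPow Y lev (2 * m) (idx n l) ω)) := by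
    intro ω
    by_cases hω : ω ∈ A
    · have hω' : ω ∉ Aᶜ := fun h => h hω
      have hgrow := h.growth n hn ω
      have hstep := drift_step_le (b := b n ω) (a := a n ω) l₀ hm (fun l => Y (idx n l) ω)
        hL hc hδ.le hδ1 (h.remainder_nonneg n hn ω) (by simpa only [h.idx_self n hn] using hgrow)
      simp only [h.idx_self n hn] at hstep
      have hf : ∀ j ≤ n, frozenPow Y lev (2 * m) j ω = Y j ω ^ (2 * m) := fun j hj =>
        if_pos fun i hi => hω i (hi.trans hj)
      simp only [y, d, Set.indicator_of_mem hω, Set.indicator_of_notMem hω', add_zero]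
      rw [hf n le_rfl, Finset.sum_congr rfl fun l _ => hf _ (h.idx_le n hn l)]
      exact hstep
    · have hω' : ω ∈ Aᶜ := hω
      have hf : frozenPow Y lev (2 * m) n ω = lev ^ (2 * m) := if_neg hω
      simp only [y, d, Set.indicator_of_notMem hω, Set.indicator_of_mem hω', hf]
      have hR := pow_nonneg (h.remainder_nonneg n hn ω) m
      have hG : gaussianRemainder m L ≤ K := by
        have := gaussianRemainder_nonneg m hL
        simp only [hK, stepConstant]
        exact le_add_of_nonneg_left (by positivity)
      have h1 : gaussianRemainder m L * δ
          ≤ δ * (K * (1 + R n ω ^ m + ∑ l, frozenPow Y lev (2 * m) (idx n l) ω)) := by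
        rw [mul_comm]
        gcongr
        refine hG.trans (le_mul_of_one_le_right hK0 ?_)
        linarith [hsum_nonneg ω]
      simp only [ne_eq, OfNat.ofNat_ne_zero, not_false_eq_true, zero_pow, mul_zero, zero_mul,
        add_zero, hm0, mul_eq_zero, or_self, mul_one, zero_add]
      linarith
  have hVi : ∀ l, Integrable (frozenPow Y lev (2 * m) (idx n l)) μ := fun l =>
    h.integrable_frozenPow (hidxN l) hlev
  have hRi := h.remainder_integrable n hn
  have hrhs : Integrable (fun ω => δ * (K * (1 + R n ω ^ m
      + ∑ l, frozenPow Y lev (2 * m) (idx n l) ω))) μ :=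
    ((((integrable_const 1).add hRi).add (integrable_finsetSum _ fun l _ => hVi l)).const_mul
      K).const_mul δ
  have hVn := h.integrable_frozenPow (lev := lev) hn.le hlev
  have hmid : Integrable (fun ω => (y ω ^ 2 + (2 * m - 1) * d ω ^ 2 * δ) ^ m
        + gaussianRemainder m L * δ * (1 + y ω ^ (2 * m))) μ := by
    have hy' : Measurable y := hy.mono (h.le n) le_rfl
    have hd' : Measurable d := hd.mono (h.le n) le_rfl
    refine (hVn.add hrhs).mono' (by fun_prop) (Filter.Eventually.of_forall fun ω => ?_)
    have hm1 : (0 : ℝ) ≤ 2 * m - 1 := by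
      have : (1 : ℝ) ≤ m := by exact_mod_cast hm
      linarith
    have hG := gaussianRemainder_nonneg m hL
    rw [Real.norm_eq_abs, abs_of_nonneg (by rw [pow_mul]; positivity)]
    have h1 := hsecond ω
    have h2 : 0 ≤ Aᶜ.indicator (fun _ => lev ^ (2 * m)) ω :=
      Set.indicator_nonneg (fun _ _ => by positivity) ω
    simp only [Pi.add_apply]
    linarith
  calc ∫ ω, frozenPow Y lev (2 * m) (n + 1) ω ∂μ
      ≤ ∫ ω, ((y ω + d ω * Z n ω) ^ (2 * m) + Aᶜ.indicator (fun _ => lev ^ (2 * m)) ω) ∂μ :=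
        integral_mono (h.integrable_frozenPow hn hlev) (hint.add hind) hfirst
    _ = ∫ ω, (y ω + d ω * Z n ω) ^ (2 * m) ∂μ
          + ∫ ω, Aᶜ.indicator (fun _ => lev ^ (2 * m)) ω ∂μ := integral_add hint hind
    _ ≤ _ := add_le_add_left hle _
    _ = ∫ ω, (((y ω ^ 2 + (2 * m - 1) * d ω ^ 2 * δ) ^ m
        + gaussianRemainder m L * δ * (1 + y ω ^ (2 * m)))
        + Aᶜ.indicator (fun _ => lev ^ (2 * m)) ω) ∂μ := (integral_add hmid hind).symm
    _ ≤ ∫ ω, (frozenPow Y lev (2 * m) n ω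
        + δ * (K * (1 + R n ω ^ m + ∑ l, frozenPow Y lev (2 * m) (idx n l) ω))) ∂μ :=
        integral_mono (hmid.add hind) (hVn.add hrhs) hsecond
    _ = ∫ ω, frozenPow Y lev (2 * m) n ω ∂μ + δ * (K * (1 + ∫ ω, R n ω ^ m ∂μ
        + ∑ l, ∫ ω, frozenPow Y lev (2 * m) (idx n l) ω ∂μ)) := by
        rw [integral_add hVn hrhs, integral_const_mul, integral_const_mul,
          integral_add (by exact (integrable_const 1).add hRi)
            (integrable_finsetSum _ fun l _ => hVi l),
          integral_add (integrable_const 1) hRi, integral_finsetSum _ fun l _ => hVi l]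
        simp
    _ ≤ _ := by
        rw [mul_assoc]
        gcongr
        exact h.remainder_moment n hn

theorem measure_exists_le_abs_le (h : IsDissipativeScheme μ l₀ m N L c ρ δ 𝓕 Y a b Z R idx)
    (hm : 1 ≤ m) (hL : 0 ≤ L) (hc : 0 ≤ c) (hρ : 0 ≤ ρ) (hδ : 0 < δ) (hδ1 : δ ≤ 1) {T y₀ : ℝ}
    (hNT : N * δ ≤ T) (hY0 : ∀ ω, |Y 0 ω| ≤ y₀) {lev : ℝ} (hlev : 0 < lev) :
    μ {ω | ∃ n ≤ N, lev ≤ |Y n ω|}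
      ≤ ENNReal.ofReal ((1 + ρ + y₀ ^ (2 * m))
        * Real.exp (stepConstant m L c (Fintype.card ι) * (1 + Fintype.card ι) * T)
          / lev ^ (2 * m)) := by
  set K := stepConstant m L c (Fintype.card ι) with hK
  have hK0 : 0 ≤ K := stepConstant_nonneg m hL hc (Nat.cast_nonneg _)
  set v : ℕ → ℝ := fun n => ∫ ω, frozenPow Y lev (2 * m) n ω ∂μ with hv
  have hv0 : v 0 ≤ 1 + ρ + y₀ ^ (2 * m) := by
    have h1 : ∀ ω, frozenPow Y lev (2 * m) 0 ω ≤ y₀ ^ (2 * m) := by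
      intro ω
      unfold frozenPow
      split_ifs with hs
      · rw [pow_mul, ← sq_abs, ← pow_mul]
        exact pow_le_pow_left₀ (abs_nonneg _) (hY0 ω) _
      · have : lev ≤ |Y 0 ω| := by
          by_contra hlt
          exact hs fun j hj => by
            obtain rfl : j = 0 := by omega
            exact not_le.1 hlt
        exact pow_le_pow_left₀ hlev.le (this.trans (hY0 ω)) _
    have h2 : v 0 ≤ ∫ _ω, y₀ ^ (2 * m) ∂μ :=
      integral_mono (h.integrable_frozenPow (Nat.zero_le _) hlev) (integrable_const _) h1
    simp at h2
    linarith
  have hy0 : 0 ≤ y₀ ^ (2 * m) := by rw [pow_mul]; positivity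
  have hvN := le_mul_one_add_pow_of_delayed_step (v := v) (K := δ * K) (by positivity) hρ
    (by linarith) hv0 h.idx_le
    (fun n hn => h.integral_frozenPow_succ_le hm hL hc hδ hδ1 hn hlev) N le_rfl
  have hexp : (1 + δ * K * (1 + Fintype.card ι)) ^ N
      ≤ Real.exp (K * (1 + Fintype.card ι) * T) := by
    calc (1 + δ * K * (1 + (Fintype.card ι : ℝ))) ^ N
        ≤ Real.exp (δ * K * (1 + Fintype.card ι)) ^ N := by
          gcongr
          rw [add_comm]
          exact Real.add_one_le_exp _
      _ = Real.exp (K * (1 + Fintype.card ι) * (N * δ)) := by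
          rw [← Real.exp_nat_mul]; congr 1; ring
      _ ≤ _ := by gcongr
  have hvN' : v N ≤ (1 + ρ + y₀ ^ (2 * m)) * Real.exp (K * (1 + Fintype.card ι) * T) :=
    hvN.trans (by gcongr)
  have hmark := mul_meas_ge_le_integral_of_nonneg
    (Filter.Eventually.of_forall fun ω => frozenPow_nonneg Y hlev m N ω)
    (h.integrable_frozenPow (lev := lev) le_rfl hlev) (lev ^ (2 * m))
  have hsub : {ω | ∃ n ≤ N, lev ≤ |Y n ω|} ⊆ {ω | lev ^ (2 * m) ≤ frozenPow Y lev (2 * m) N ω} := by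
    rintro ω ⟨n, hn, hω⟩
    have : ω ∉ staysBelow Y lev N := fun hs => absurd (hs n hn) (not_lt.2 hω)
    simp only [Set.mem_ofPred_eq, frozenPow, if_neg this, le_refl]
  have hpos : 0 < lev ^ (2 * m) := by positivity
  calc μ {ω | ∃ n ≤ N, lev ≤ |Y n ω|}
      ≤ μ {ω | lev ^ (2 * m) ≤ frozenPow Y lev (2 * m) N ω} := measure_mono hsub
    _ = ENNReal.ofReal (μ.real {ω | lev ^ (2 * m) ≤ frozenPow Y lev (2 * m) N ω}) := by
        rw [ofReal_measureReal]
    _ ≤ _ := by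
        refine ENNReal.ofReal_le_ofReal ?_
        rw [le_div_iff₀ hpos, mul_comm]
        exact hmark.trans hvN'

end IsDissipativeScheme

/-- A standard Brownian motion on `[0, ∞)`, with continuous paths. -/
structure IsBrownianPath {Ω : Type*} [MeasurableSpace Ω] (μ : Measure Ω) (B : ℝ → Ω → ℝ) :
    Prop where
  continuous : ∀ ω, Continuous fun t => B t ω
  measurable : ∀ t, Measurable (B t)
  map_sub : ∀ s t : ℝ, 0 ≤ s → s ≤ t →
    μ.map (fun ω => B t ω - B s ω) = gaussianReal 0 (Real.toNNReal (t - s))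
  indepFun : ∀ s t : ℝ, 0 ≤ s → s ≤ t →
    IndepFun (fun ω => B t ω - B s ω) (fun ω (u : Set.Icc (0 : ℝ) s) => B (u : ℝ) ω) μ

/-- The information carried by the path `B` up to time `s`. -/
abbrev pastSigma {Ω : Type*} (B : ℝ → Ω → ℝ) (s : ℝ) : MeasurableSpace Ω :=
  MeasurableSpace.comap (fun ω (u : Set.Icc (0 : ℝ) s) => B (u : ℝ) ω) inferInstance

lemma measurable_pastSigma {Ω : Type*} (B : ℝ → Ω → ℝ) {t s : ℝ} (ht : 0 ≤ t) (hts : t ≤ s) :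
    Measurable[pastSigma B s] (B t) :=
  (measurable_pi_apply (⟨t, ht, hts⟩ : Set.Icc (0 : ℝ) s)).comp
    (comap_measurable fun ω (u : Set.Icc (0 : ℝ) s) => B (u : ℝ) ω)

lemma pastSigma_mono {Ω : Type*} (B : ℝ → Ω → ℝ) {s t : ℝ} (hst : s ≤ t) :
    pastSigma B s ≤ pastSigma B t :=
  Measurable.comap_le
    (@measurable_pi_lambda _ _ _ (pastSigma B t) _ _ fun u =>
      measurable_pastSigma B u.2.1 (u.2.2.trans hst))

lemma IsBrownianPath.pastSigma_le {Ω : Type*} [mΩ : MeasurableSpace Ω] {μ : Measure Ω}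
    {B : ℝ → Ω → ℝ} (hB : IsBrownianPath μ B) (s : ℝ) : pastSigma B s ≤ mΩ :=
  Measurable.comap_le (measurable_pi_lambda _ fun u => hB.measurable u)

lemma IsBrownianPath.indep {Ω : Type*} [MeasurableSpace Ω] {μ : Measure Ω}
    {B : ℝ → Ω → ℝ} (hB : IsBrownianPath μ B) {s t : ℝ} (hs : 0 ≤ s) (hst : s ≤ t) :
    Indep (pastSigma B s)
      (MeasurableSpace.comap (fun ω => B t ω - B s ω) inferInstance) μ :=
  ((IndepFun_iff_Indep _ _ _).1 (hB.indepFun s t hs hst)).symm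

lemma IsBrownianPath.increment_moment {Ω : Type*} [MeasurableSpace Ω] {μ : Measure Ω}
    [IsProbabilityMeasure μ]
    {B : ℝ → Ω → ℝ} (hB : IsBrownianPath μ B) {s t Δ : ℝ} (hs : 0 ≤ s) (hst : s ≤ t)
    (hΔ : 0 < Δ) (htΔ : t - s ≤ Δ) (m : ℕ) :
    Integrable (fun ω => (1 + (B t ω - B s ω) ^ 2 / Δ) ^ m) μ ∧
    ∫ ω, (1 + (B t ω - B s ω) ^ 2 / Δ) ^ m ∂μ
      ≤ 2 ^ (m - 1) * (1 + ∫ z, z ^ (2 * m) ∂(gaussianReal 0 1)) := by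
  have hBt := hB.measurable t
  have hBs := hB.measurable s
  set W : Ω → ℝ := fun ω => B t ω - B s ω with hW
  have hWm : Measurable W := hBt.sub hBs
  have hlaw := hB.map_sub s t hs hst
  have hWi : Integrable (fun ω => W ω ^ (2 * m)) μ := by
    have := integrable_pow_gaussianReal (t - s).toNNReal (2 * m)
    rw [← hlaw] at this
    exact (integrable_map_measure (continuous_pow _).aestronglyMeasurable hWm.aemeasurable).1 this
  have hWint : ∫ ω, W ω ^ (2 * m) ∂μ
      = (t - s) ^ m * ∫ z, z ^ (2 * m) ∂(gaussianReal 0 1) := by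
    have h1 := integral_pow_gaussianReal (sub_nonneg.2 hst) (2 * m)
    rw [← hlaw, integral_map hWm.aemeasurable (continuous_pow _).aestronglyMeasurable,
      pow_mul, Real.sq_sqrt (sub_nonneg.2 hst)] at h1
    exact h1
  have hdom : ∀ ω, (1 + W ω ^ 2 / Δ) ^ m ≤ 2 ^ (m - 1) * (1 + W ω ^ (2 * m) / Δ ^ m) := by
    intro ω
    have := add_pow_le zero_le_one (show 0 ≤ W ω ^ 2 / Δ by positivity) m
    rwa [one_pow, div_pow, ← pow_mul] at this
  have hdomi : Integrable (fun ω => 2 ^ (m - 1) * (1 + W ω ^ (2 * m) / Δ ^ m)) μ :=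
    ((integrable_const _).add (hWi.div_const _)).const_mul _
  have hint : Integrable (fun ω => (1 + W ω ^ 2 / Δ) ^ m) μ := by
    refine hdomi.mono' (by fun_prop) (Filter.Eventually.of_forall fun ω => ?_)
    rw [Real.norm_eq_abs, abs_of_nonneg (by positivity)]
    exact hdom ω
  refine ⟨hint, (integral_mono hint hdomi hdom).trans ?_⟩
  rw [integral_const_mul, integral_add (integrable_const _) (hWi.div_const _), integral_div,
    hWint]
  have hg : 0 ≤ ∫ z, z ^ (2 * m) ∂(gaussianReal 0 1) :=
    integral_nonneg fun z => by simp only [Pi.zero_apply]; rw [pow_mul]; positivity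
  have hq : (t - s) ^ m / Δ ^ m ≤ 1 := by
    rw [← div_pow]
    exact pow_le_one₀ (div_nonneg (sub_nonneg.2 hst) hΔ.le) ((div_le_one hΔ).2 htΔ)
  simp only [integral_const, probReal_univ, smul_eq_mul, mul_one]
  gcongr
  calc (t - s) ^ m * (∫ z, z ^ (2 * m) ∂(gaussianReal 0 1)) / Δ ^ m
      = (t - s) ^ m / Δ ^ m * ∫ z, z ^ (2 * m) ∂(gaussianReal 0 1) := by ring
    _ ≤ _ := mul_le_of_le_one_left hg hq

/-- Truncated coefficients of size at most `G`, with `G ^ 4 * Δ ≤ L`, satisfying a Khasminskii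
condition of order `2 * m`, and a delay term of linear growth. -/
structure IsTamedCoeff {r : ℕ} (m : ℕ) (G Δ L c₁ c₃ : ℝ) (A D : ℝ → ℝ)
    (α₃ : (Fin r → ℝ) → ℝ) : Prop where
  measurable_drift : Measurable A
  measurable_diffusion : Measurable D
  measurable_delay : Measurable α₃
  abs_drift_le : ∀ x, |A x| ≤ 2 * G
  abs_diffusion_le : ∀ x, |D x| ≤ G
  size_le : G ^ 4 * Δ ≤ L
  khasminskii : ∀ x, 2 * x * A x + (2 * m - 1) * D x ^ 2 ≤ c₁ * (1 + x ^ 2)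
  delay_sq_le : ∀ y, α₃ y ^ 2 ≤ c₃ * (1 + ∑ v, y v ^ 2)

/-- The explicit Euler–Maruyama scheme `X` with delays `k v * Δ` and its continuous version `χ`,
started from a deterministic history bounded by `Ξ`. -/
structure IsDelayEM {Ω : Type*} {r : ℕ} (B : ℝ → Ω → ℝ) (Δ : ℝ) (MT : ℕ) (k : Fin r → ℕ)
    (A D : ℝ → ℝ) (α₃ : (Fin r → ℝ) → ℝ) (Ξ : ℝ) (X : ℤ → Ω → ℝ) (χ : ℝ → Ω → ℝ) : Prop where
  history : ∀ j : ℤ, (j = 0 ∨ ∃ v, -(k v : ℤ) ≤ j) → j ≤ 0 → ∃ x, |x| ≤ Ξ ∧ ∀ ω, X j ω = x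
  recursion : ∀ j : ℕ, j < MT → ∀ ω, X ((j : ℤ) + 1) ω = X (j : ℤ) ω
    + (A (X (j : ℤ) ω) + α₃ (fun v => X ((j : ℤ) - (k v : ℤ)) ω)) * Δ
    + D (X (j : ℤ) ω) * (B (((j : ℝ) + 1) * Δ) ω - B ((j : ℝ) * Δ) ω)
  interpolation : ∀ j : ℕ, j < MT → ∀ t ∈ Set.Icc ((j : ℝ) * Δ) (((j : ℝ) + 1) * Δ), ∀ ω,
    χ t ω = X (j : ℤ) ω
      + (A (X (j : ℤ) ω) + α₃ (fun v => X ((j : ℤ) - (k v : ℤ)) ω)) * (t - (j : ℝ) * Δ)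
      + D (X (j : ℤ) ω) * (B t ω - B ((j : ℝ) * Δ) ω)

/-- The growth constant of the Euler–Maruyama scheme observed on a finer grid. -/
noncomputable def schemeConstant (r : ℕ) (L c₁ c₃ Ξ : ℝ) : ℝ :=
  c₁ + 20 * (1 + L) + 4 * c₃ * (1 + r * Ξ ^ 2) + 2 + 4 * L

lemma le_schemeConstant_mul {L c₁ c₃ Ξ s w x y : ℝ} {r : ℕ} (hc₁ : 0 ≤ c₁) (hc₃ : 0 ≤ c₃)
    (hL : 0 ≤ L) (hs : 0 ≤ s) (hw : 0 ≤ w) :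
    c₁ * (1 + x ^ 2) + 20 * (1 + L) + 4 * (c₃ * (1 + (r * Ξ ^ 2 + s))) + y ^ 2 + 1 + 4 * L * w
      ≤ schemeConstant r L c₁ c₃ Ξ * (1 + w + (y ^ 2 + (x ^ 2 + s))) := by
  have hx2 := sq_nonneg x
  have hy2 := sq_nonneg y
  have hΞ : 0 ≤ r * Ξ ^ 2 := by positivity
  have e1 : 0 ≤ c₁ * (w + y ^ 2 + s) := by positivity
  have e2 : 0 ≤ 20 * (1 + L) * (w + y ^ 2 + x ^ 2 + s) := by positivity
  have e3 : 0 ≤ 4 * c₃ * (r * Ξ ^ 2 * (w + y ^ 2 + x ^ 2 + s) + w + y ^ 2 + x ^ 2) := by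
    positivity
  have e4 : 0 ≤ 4 * L * (1 + y ^ 2 + x ^ 2 + s) := by positivity
  have e5 : 0 ≤ 1 + 2 * w + y ^ 2 + 2 * x ^ 2 + 2 * s := by positivity
  unfold schemeConstant
  linarith only [e1, e2, e3, e4, e5]

lemma sq_mul_le_of_frozen_coeff {G Δ θ L A : ℝ} (hΔ : 0 < Δ) (hΔ1 : Δ ≤ 1) (hθΔ : θ ≤ Δ)
    (hL : 0 ≤ L) (hA : |A| ≤ 2 * G) (hG : G ^ 4 * Δ ≤ L) :
    A ^ 2 * θ ≤ 4 * (1 + L) := by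
  have hAsq : A ^ 2 ≤ 4 * G ^ 2 := by
    calc A ^ 2 = |A| ^ 2 := (sq_abs A).symm
      _ ≤ (2 * G) ^ 2 := pow_le_pow_left₀ (abs_nonneg A) hA 2
      _ = 4 * G ^ 2 := by ring
  have hG2 : G ^ 2 * Δ ≤ 1 + L := by
    have h1 : (G ^ 2 * Δ) ^ 2 ≤ L := by
      calc (G ^ 2 * Δ) ^ 2 = G ^ 4 * Δ * Δ := by ring
        _ ≤ L * 1 := by gcongr
        _ = L := mul_one L
    linarith only [h1, sq_nonneg (G ^ 2 * Δ - 1), sq_nonneg (G ^ 2 * Δ), hL]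
  calc A ^ 2 * θ ≤ A ^ 2 * Δ := mul_le_mul_of_nonneg_left hθΔ (sq_nonneg A)
    _ ≤ 4 * G ^ 2 * Δ := mul_le_mul_of_nonneg_right hAsq hΔ.le
    _ = 4 * (G ^ 2 * Δ) := by ring
    _ ≤ 4 * (1 + L) := by gcongr

lemma noise_cross_le_of_frozen_coeff {G Δ L A b W : ℝ} (hΔ : 0 < Δ)
    (hA : |A| ≤ 2 * G) (hb : |b| ≤ G) (hG : G ^ 4 * Δ ≤ L) :
    2 * A * b * W ≤ 1 + 4 * L * (W ^ 2 / Δ) := by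
  have hG0 : 0 ≤ G := (abs_nonneg _).trans hb
  have h1 : 2 * A * b * W ≤ 2 * (2 * G) * G * |W| := by
    calc 2 * A * b * W ≤ |2 * A * b * W| := le_abs_self _
      _ = 2 * |A| * |b| * |W| := by rw [abs_mul, abs_mul, abs_mul, abs_two]
      _ ≤ _ := by gcongr
  have h2 : 2 * (2 * G) * G * |W| ≤ 1 + 4 * (G ^ 4 * W ^ 2) := by
    rw [← sq_abs W]
    linarith only [sq_nonneg (1 - 2 * G ^ 2 * |W|)]
  have h3 : G ^ 4 * W ^ 2 ≤ L * (W ^ 2 / Δ) := by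
    calc G ^ 4 * W ^ 2 = G ^ 4 * Δ * (W ^ 2 / Δ) := by field_simp
      _ ≤ _ := by gcongr
  linarith only [h1, h2, h3]

lemma growth_le_of_frozen_coeff {G Δ δ θ L c₁ c₃ q Ξ s : ℝ} {r : ℕ} {x y A a b W : ℝ}
    (hΔ : 0 < Δ) (hΔ1 : Δ ≤ 1) (hδ : 0 ≤ δ) (hδΔ : δ ≤ Δ) (hθ : 0 ≤ θ) (hθΔ : θ ≤ Δ)
    (hc₁ : 0 ≤ c₁) (hc₃ : 0 ≤ c₃) (hL : 0 ≤ L) (hs : 0 ≤ s)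
    (hy : y = x + (A + a) * θ + b * W) (hA : |A| ≤ 2 * G) (hb : |b| ≤ G)
    (hG : G ^ 4 * Δ ≤ L) (hk : 2 * x * A + q * b ^ 2 ≤ c₁ * (1 + x ^ 2))
    (ha : a ^ 2 ≤ c₃ * (1 + (r * Ξ ^ 2 + s))) :
    2 * y * (A + a) + q * b ^ 2 + (A + a) ^ 2 * δ
      ≤ schemeConstant r L c₁ c₃ Ξ * (1 + W ^ 2 / Δ + (y ^ 2 + (x ^ 2 + s))) := by
  refine le_trans ?_ (le_schemeConstant_mul hc₁ hc₃ hL hs (by positivity))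
  have hAθ := sq_mul_le_of_frozen_coeff hΔ hΔ1 hθΔ hL hA hG
  have hAδ := sq_mul_le_of_frozen_coeff hΔ hΔ1 hδΔ hL hA hG
  have hW := noise_cross_le_of_frozen_coeff (W := W) hΔ hA hb hG
  have haθ : a ^ 2 * θ ≤ a ^ 2 := mul_le_of_le_one_right (sq_nonneg a) (hθΔ.trans hΔ1)
  have haδ : a ^ 2 * δ ≤ a ^ 2 := mul_le_of_le_one_right (sq_nonneg a) (hδΔ.trans hΔ1)
  have hcross : 2 * A * a * θ ≤ A ^ 2 * θ + a ^ 2 * θ := by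
    linarith only [mul_nonneg hθ (sq_nonneg (A - a))]
  have hsq : (A + a) ^ 2 * δ ≤ 2 * (A ^ 2 * δ) + 2 * (a ^ 2 * δ) := by
    linarith only [mul_nonneg hδ (sq_nonneg (A - a))]
  have hya : 2 * y * a ≤ y ^ 2 + a ^ 2 := two_mul_le_add_sq y a
  have hyA : 2 * y * A = 2 * x * A + 2 * (A ^ 2 * θ) + 2 * A * a * θ + 2 * A * b * W := by
    rw [hy]; ring
  have hsplit : 2 * y * (A + a) = 2 * y * A + 2 * y * a := by ring
  linarith only [hAθ, hAδ, hW, haθ, haδ, hcross, hsq, hya, hyA, hsplit, hk, ha, hL]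

/-- The grid points at which a step of the refined scheme evaluates the process: the present one,
the last coarse grid point, and the delayed coarse grid points. -/
def refinedIdx {r : ℕ} (K : ℕ) (k : Fin r → ℕ) (n : ℕ) : Option (Option (Fin r)) → ℕ
  | none => n
  | some none => n / K * K
  | some (some v) => (n / K - k v) * K

namespace IsDelayEM

variable {Ω : Type*} {r : ℕ} {B : ℝ → Ω → ℝ} {Δ : ℝ} {MT : ℕ} {k : Fin r → ℕ}
    {A D : ℝ → ℝ} {α₃ : (Fin r → ℝ) → ℝ} {Ξ : ℝ} {X : ℤ → Ω → ℝ} {χ : ℝ → Ω → ℝ}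

lemma measurable_scheme (h : IsDelayEM B Δ MT k A D α₃ Ξ X χ) (hΔ : 0 ≤ Δ)
    (hA : Measurable A) (hD : Measurable D) (hα₃ : Measurable α₃) (j : ℕ) :
    j ≤ MT → Measurable[pastSigma B (j * Δ)] (X j) ∧
      ∀ v, Measurable[pastSigma B (j * Δ)] (X ((j : ℤ) - (k v : ℤ))) := by
  have hhist : ∀ (i : ℤ) (s : ℝ), (i = 0 ∨ ∃ v, -(k v : ℤ) ≤ i) → i ≤ 0 →
      Measurable[pastSigma B s] (X i) := by
    intro i s hi hi0
    obtain ⟨x, -, hx⟩ := h.history i hi hi0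
    rw [show X i = fun _ => x from funext hx]
    exact measurable_const
  induction j using Nat.strong_induction_on with
  | _ j ih =>
    intro hj
    have hself : Measurable[pastSigma B (j * Δ)] (X j) := by
      rcases j with _ | i
      · exact hhist _ _ (Or.inl rfl) le_rfl
      · obtain ⟨h1, h2⟩ := ih i (Nat.lt_succ_self i) (by omega)
        have hmono : pastSigma B (i * Δ) ≤ pastSigma B ((i + 1 : ℕ) * Δ) :=
          pastSigma_mono B (by push_cast; nlinarith)
        replace h1 := h1.mono hmono le_rfl
        replace h2 := fun v => (h2 v).mono hmono le_rfl
        have hB1 : Measurable[pastSigma B ((i + 1 : ℕ) * Δ)] (B (((i : ℝ) + 1) * Δ)) :=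
          measurable_pastSigma B (by positivity) (by push_cast; exact le_rfl)
        have hB0 : Measurable[pastSigma B ((i + 1 : ℕ) * Δ)] (B ((i : ℝ) * Δ)) :=
          measurable_pastSigma B (by positivity) (by push_cast; nlinarith)
        rw [show X ((i + 1 : ℕ) : ℤ) = _ from funext (h.recursion i (by omega))]
        exact (h1.add (((hA.comp h1).add
          (hα₃.comp (@measurable_pi_lambda _ _ _ (_) _ _ h2))).mul measurable_const)).add
          ((hD.comp h1).mul (hB1.sub hB0))
    refine ⟨hself, fun v => ?_⟩
    rcases le_or_gt (j : ℤ) (k v : ℤ) with hle | hlt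
    · exact hhist _ _ (Or.inr ⟨v, by omega⟩) (by omega)
    · rcases Nat.eq_zero_or_pos (k v) with h0 | hpos
      · simpa [h0] using hself
      · have hcast : (j : ℤ) - (k v : ℤ) = ((j - k v : ℕ) : ℤ) := by omega
        rw [hcast]
        refine (ih (j - k v) (by omega) (by omega)).1.mono (pastSigma_mono B ?_) le_rfl
        gcongr
        exact Nat.sub_le _ _

lemma eq_scheme (h : IsDelayEM B Δ MT k A D α₃ Ξ X χ) (hΔ : 0 ≤ Δ) {j : ℕ} (hj : j < MT)
    (ω : Ω) : χ (j * Δ) ω = X j ω := by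
  rw [h.interpolation j hj (j * Δ) ⟨le_rfl, by nlinarith⟩ ω]
  ring

lemma measurable_interpolation (h : IsDelayEM B Δ MT k A D α₃ Ξ X χ) (hΔ : 0 ≤ Δ)
    (hA : Measurable A) (hD : Measurable D) (hα₃ : Measurable α₃) {j : ℕ} (hj : j < MT)
    {t : ℝ} (ht : t ∈ Set.Icc ((j : ℝ) * Δ) (((j : ℝ) + 1) * Δ)) :
    Measurable[pastSigma B t] (χ t) := by
  obtain ⟨h1, h2⟩ := h.measurable_scheme hΔ hA hD hα₃ j hj.le
  have hj0 : 0 ≤ (j : ℝ) * Δ := by positivity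
  have hmono : pastSigma B (j * Δ) ≤ pastSigma B t := pastSigma_mono B ht.1
  replace h1 := h1.mono hmono le_rfl
  replace h2 := fun v => (h2 v).mono hmono le_rfl
  have hB1 : Measurable[pastSigma B t] (B t) := measurable_pastSigma B (hj0.trans ht.1) le_rfl
  have hB0 : Measurable[pastSigma B t] (B ((j : ℝ) * Δ)) := measurable_pastSigma B hj0 ht.1
  rw [show χ t = _ from funext (h.interpolation j hj t ht)]
  exact (h1.add (((hA.comp h1).add
    (hα₃.comp (@measurable_pi_lambda _ _ _ (_) _ _ h2))).mul measurable_const)).add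
    ((hD.comp h1).mul (hB1.sub hB0))

lemma sum_delayed_sq_le (h : IsDelayEM B Δ MT k A D α₃ Ξ X χ) (hΔ : 0 ≤ Δ) {j : ℕ} (hj : j < MT)
    (ω : Ω) :
    ∑ v, X ((j : ℤ) - (k v : ℤ)) ω ^ 2 ≤ r * Ξ ^ 2 + ∑ v, χ ((j - k v : ℕ) * Δ) ω ^ 2 := by
  have : (r : ℝ) * Ξ ^ 2 = ∑ _v : Fin r, Ξ ^ 2 := by simp
  rw [this, ← Finset.sum_add_distrib]
  refine Finset.sum_le_sum fun v _ => ?_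
  rcases le_or_gt (j : ℤ) (k v : ℤ) with hle | hlt
  · obtain ⟨x, hx, hX⟩ := h.history ((j : ℤ) - (k v : ℤ)) (Or.inr ⟨v, by omega⟩) (by omega)
    rw [hX ω, ← sq_abs x]
    have := pow_le_pow_left₀ (abs_nonneg x) hx 2
    nlinarith [sq_nonneg (χ ((j - k v : ℕ) * Δ) ω)]
  · have hcast : (j : ℤ) - (k v : ℤ) = ((j - k v : ℕ) : ℤ) := by omega
    rw [h.eq_scheme hΔ (by omega), hcast]
    nlinarith [sq_nonneg Ξ]

variable [MeasurableSpace Ω] {μ : Measure Ω} [IsProbabilityMeasure μ] {m : ℕ} {G L c₁ c₃ : ℝ}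

/-- Observed on the grid of step `Δ / K`, the continuous version of the Euler–Maruyama scheme is
a dissipative scheme with coefficients frozen between the coarse grid points. -/
lemma isDissipativeScheme (h : IsDelayEM B Δ MT k A D α₃ Ξ X χ) (hB : IsBrownianPath μ B)
    (hC : IsTamedCoeff m G Δ L c₁ c₃ A D α₃) (hΔ : 0 < Δ) (hΔ1 : Δ ≤ 1) (hMT : 0 < MT)
    (hL : 0 ≤ L) (hc₁ : 0 ≤ c₁) (hc₃ : 0 ≤ c₃) {K : ℕ} (hK : 0 < K) {δ : ℝ}
    (hδ : Δ = K * δ) :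
    IsDissipativeScheme μ (none : Option (Option (Fin r))) m (MT * K) L
      (schemeConstant r L c₁ c₃ Ξ)
      (2 ^ (m - 1) * (1 + ∫ z, z ^ (2 * m) ∂(gaussianReal 0 1))) δ
      (fun n => pastSigma B (n * δ)) (fun n => χ (n * δ))
      (fun n ω => A (X (n / K : ℕ) ω) + α₃ (fun v => X (((n / K : ℕ) : ℤ) - (k v : ℤ)) ω))
      (fun n ω => D (X (n / K : ℕ) ω))
      (fun n ω => B (((n : ℝ) + 1) * δ) ω - B (n * δ) ω)
      (fun n ω => 1 + (B (n * δ) ω - B ((n / K : ℕ) * Δ) ω) ^ 2 / Δ)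
      (refinedIdx K k) := by
  have hK1 : (1 : ℝ) ≤ K := by exact_mod_cast hK
  have hδ0 : 0 < δ := by
    rcases lt_or_ge 0 δ with h0 | h0
    · exact h0
    · nlinarith
  have hδΔ : δ ≤ Δ := by nlinarith
  have hblock : ∀ n < MT * K, n / K < MT := fun n hn => Nat.div_lt_of_lt_mul (by rwa [mul_comm])
  have hlow : ∀ n : ℕ, ((n / K : ℕ) : ℝ) * Δ ≤ n * δ := by
    intro n
    have : ((n / K * K : ℕ) : ℝ) ≤ n := by exact_mod_cast Nat.div_mul_le_self n K
    rw [hδ, ← mul_assoc]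
    push_cast at this
    gcongr
  have hup : ∀ n : ℕ, ((n : ℝ) + 1) * δ ≤ (((n / K : ℕ) : ℝ) + 1) * Δ := by
    intro n
    have : ((n + 1 : ℕ) : ℝ) ≤ ((n / K + 1) * K : ℕ) := by
      exact_mod_cast (mul_comm K _) ▸ Nat.lt_mul_div_succ n hK
    rw [hδ, ← mul_assoc]
    push_cast at this
    gcongr
  have hmem : ∀ n : ℕ, (n : ℝ) * δ ∈ Set.Icc (((n / K : ℕ) : ℝ) * Δ) ((((n / K : ℕ) : ℝ) + 1) * Δ) :=
    fun n => ⟨hlow n, le_trans (by nlinarith) (hup n)⟩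
  have hmem' : ∀ n : ℕ, ((n : ℝ) + 1) * δ ∈
      Set.Icc (((n / K : ℕ) : ℝ) * Δ) ((((n / K : ℕ) : ℝ) + 1) * Δ) :=
    fun n => ⟨le_trans (hlow n) (by nlinarith), hup n⟩
  have hscheme : ∀ n < MT * K, Measurable[pastSigma B (n * δ)] (X (n / K : ℕ)) ∧
      ∀ v, Measurable[pastSigma B (n * δ)] (X (((n / K : ℕ) : ℤ) - (k v : ℤ))) := by
    intro n hn
    obtain ⟨h1, h2⟩ := h.measurable_scheme hΔ.le hC.measurable_drift hC.measurable_diffusion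
      hC.measurable_delay (n / K) (hblock n hn).le
    have hmono := pastSigma_mono B (hlow n)
    exact ⟨h1.mono hmono le_rfl, fun v => (h2 v).mono hmono le_rfl⟩
  have hsum : ∀ n : ℕ, ∀ ω, ∑ l, χ ((refinedIdx K k n l : ℕ) * δ) ω ^ 2
      = χ (n * δ) ω ^ 2 + (χ ((n / K : ℕ) * Δ) ω ^ 2
        + ∑ v, χ ((n / K - k v : ℕ) * Δ) ω ^ 2) := by
    intro n ω
    simp only [Fintype.sum_option, refinedIdx, Nat.cast_mul, hδ, mul_assoc]
  have hdelay : ∀ n < MT * K, ∀ ω,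
      α₃ (fun v => X (((n / K : ℕ) : ℤ) - (k v : ℤ)) ω) ^ 2
        ≤ c₃ * (1 + (r * Ξ ^ 2 + ∑ v, χ ((n / K - k v : ℕ) * Δ) ω ^ 2)) := by
    intro n hn ω
    refine (hC.delay_sq_le _).trans ?_
    gcongr
    exact h.sum_delayed_sq_le hΔ.le (hblock n hn) ω
  have hmoment : ∀ n : ℕ, _ := fun n => hB.increment_moment
    (s := (n / K : ℕ) * Δ) (t := n * δ) (by positivity) (hlow n) hΔ
    (by linarith [(hmem n).2]) m
  refine
    { le := fun n => hB.pastSigma_le _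
      measurable_process := ?_
      measurable_drift := ?_
      measurable_diffusion := fun n hn => hC.measurable_diffusion.comp (hscheme n hn).1
      measurable_noise := fun n _ => (hB.measurable _).sub (hB.measurable _)
      law_noise := ?_
      indep_noise := fun n _ => hB.indep (by positivity) (by nlinarith)
      recursion := ?_
      diffusion_bound := ?_
      drift_bound := ⟨2 * (2 * G) ^ 2 + 2 * (c₃ * (1 + r * Ξ ^ 2)), ?_⟩
      remainder_nonneg := fun n _ ω => by positivity
      remainder_integrable := fun n _ => (hmoment n).1
      remainder_moment := fun n _ => (hmoment n).2
      idx_le := ?_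
      idx_self := fun n _ => rfl
      growth := ?_ }
  · intro n hn j hj
    have hjn : pastSigma B (j * δ) ≤ pastSigma B (n * δ) := pastSigma_mono B (by gcongr)
    refine Measurable.mono ?_ hjn le_rfl
    rcases lt_or_eq_of_le (hj.trans hn) with hlt | rfl
    · exact h.measurable_interpolation hΔ.le hC.measurable_drift hC.measurable_diffusion
        hC.measurable_delay (hblock j hlt) (hmem j)
    · refine h.measurable_interpolation hΔ.le hC.measurable_drift hC.measurable_diffusion
        hC.measurable_delay (Nat.sub_lt hMT one_pos) ?_
      have : ((MT * K : ℕ) : ℝ) * δ = (((MT - 1 : ℕ) : ℝ) + 1) * Δ := by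
        rw [hδ]; push_cast [Nat.cast_sub (show 1 ≤ MT from hMT)]; ring
      rw [this]
      exact ⟨by nlinarith, le_rfl⟩
  · intro n hn
    obtain ⟨h1, h2⟩ := hscheme n hn
    exact (hC.measurable_drift.comp h1).add
      (hC.measurable_delay.comp (@measurable_pi_lambda _ _ _ (_) _ _ h2))
  · intro n _
    rw [hB.map_sub _ _ (by positivity) (by nlinarith)]
    congr 2
    ring
  · intro n hn ω
    rw [Nat.cast_add, Nat.cast_one, h.interpolation _ (hblock n hn) _ (hmem' n) ω,
      h.interpolation _ (hblock n hn) _ (hmem n) ω]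
    ring
  · intro n _ ω
    refine le_trans ?_ hC.size_le
    have h1 : D (X (n / K : ℕ) ω) ^ 4 ≤ G ^ 4 := by
      calc D (X (n / K : ℕ) ω) ^ 4 = |D (X (n / K : ℕ) ω)| ^ 4 := by
            rw [Even.pow_abs (by decide)]
        _ ≤ G ^ 4 := pow_le_pow_left₀ (abs_nonneg _) (hC.abs_diffusion_le _) 4
    exact mul_le_mul h1 hδΔ hδ0.le (by positivity)
  · intro n hn ω
    have h1 := hdelay n hn ω
    have h2 : A (X (n / K : ℕ) ω) ^ 2 ≤ (2 * G) ^ 2 := by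
      rw [← sq_abs]; exact pow_le_pow_left₀ (abs_nonneg _) (hC.abs_drift_le _) 2
    rw [hsum n ω]
    set s := ∑ v, χ ((n / K - k v : ℕ) * Δ) ω ^ 2
    set a := A (X (n / K : ℕ) ω)
    set e := α₃ (fun v => X (((n / K : ℕ) : ℤ) - (k v : ℤ)) ω)
    set y := χ (n * δ) ω
    set x := χ ((n / K : ℕ) * Δ) ω
    have hs : 0 ≤ s := Finset.sum_nonneg fun v _ => sq_nonneg _
    have e1 : 0 ≤ 2 * (2 * G) ^ 2 * (y ^ 2 + (x ^ 2 + s)) := by positivity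
    have e2 : 0 ≤ 2 * (c₃ * (r * Ξ ^ 2 * (y ^ 2 + (x ^ 2 + s)) + y ^ 2 + x ^ 2)) := by positivity
    linarith only [sq_nonneg (a - e), h1, h2, e1, e2]
  · rintro n hn (_ | _ | v)
    · exact le_rfl
    · exact Nat.div_mul_le_self n K
    · exact (Nat.mul_le_mul_right K (Nat.sub_le _ _)).trans (Nat.div_mul_le_self n K)
  · intro n hn ω
    rw [hsum n ω, h.eq_scheme hΔ.le (hblock n hn)]
    refine growth_le_of_frozen_coeff (θ := n * δ - (n / K : ℕ) * Δ) hΔ hΔ1 hδ0.le hδΔ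
      (by linarith [hlow n]) (by linarith [(hmem n).2]) hc₁ hc₃ hL
      (Finset.sum_nonneg fun v _ => sq_nonneg _) ?_ (hC.abs_drift_le _) (hC.abs_diffusion_le _)
      hC.size_le (hC.khasminskii _) (hdelay n hn ω)
    exact h.interpolation _ (hblock n hn) _ (hmem n) ω

end IsDelayEM

lemma exists_mem_block {Δ t : ℝ} {MT : ℕ} (hΔ : 0 < Δ) (hMT : 0 < MT)
    (ht : t ∈ Set.Icc 0 ((MT : ℝ) * Δ)) :
    ∃ i < MT, t ∈ Set.Icc ((i : ℝ) * Δ) (((i : ℝ) + 1) * Δ) := by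
  have hq : 0 ≤ t / Δ := div_nonneg ht.1 hΔ.le
  rcases lt_or_ge ⌊t / Δ⌋₊ MT with hlt | hge
  · exact ⟨⌊t / Δ⌋₊, hlt, (le_div_iff₀ hΔ).1 (Nat.floor_le hq),
      (div_le_iff₀ hΔ).1 (Nat.lt_floor_add_one _).le⟩
  · have h1 : (MT : ℝ) ≤ t / Δ := (Nat.cast_le.2 hge).trans (Nat.floor_le hq)
    have h2 : t = MT * Δ := le_antisymm ht.2 ((le_div_iff₀ hΔ).1 h1)
    refine ⟨MT - 1, Nat.sub_lt hMT one_pos, ?_⟩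
    rw [Nat.cast_sub (show 1 ≤ MT from hMT), Nat.cast_one, sub_add_cancel, h2]
    exact ⟨by nlinarith, le_rfl⟩

/-- The constant in the weak-type bound for the running maximum of the scheme. -/
noncomputable def maximalConstant (r m : ℕ) (L c₁ c₃ Ξ T : ℝ) : ℝ :=
  (1 + 2 ^ (m - 1) * (1 + ∫ z, z ^ (2 * m) ∂(gaussianReal 0 1)) + Ξ ^ (2 * m)) *
    Real.exp (stepConstant m L (schemeConstant r L c₁ c₃ Ξ) (r + 1 + 1 : ℕ) *
      (1 + (r + 1 + 1 : ℕ)) * T)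

lemma maximalConstant_nonneg (r m : ℕ) (L c₁ c₃ Ξ T : ℝ) :
    0 ≤ maximalConstant r m L c₁ c₃ Ξ T := by
  have : 0 ≤ ∫ z, z ^ (2 * m) ∂(gaussianReal 0 1) :=
    integral_nonneg fun z => by simp only [Pi.zero_apply]; rw [pow_mul]; positivity
  have : 0 ≤ Ξ ^ (2 * m) := by rw [pow_mul]; positivity
  unfold maximalConstant
  positivity

namespace IsDelayEM

variable {Ω : Type*} {r : ℕ} {B : ℝ → Ω → ℝ} {Δ : ℝ} {MT : ℕ} {k : Fin r → ℕ}
    {A D : ℝ → ℝ} {α₃ : (Fin r → ℝ) → ℝ} {Ξ : ℝ} {X : ℤ → Ω → ℝ} {χ : ℝ → Ω → ℝ}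

lemma continuousOn_block (h : IsDelayEM B Δ MT k A D α₃ Ξ X χ) {ω : Ω}
    (hB : Continuous fun t => B t ω) {i : ℕ} (hi : i < MT) :
    ContinuousOn (fun t => χ t ω) (Set.Icc ((i : ℝ) * Δ) (((i : ℝ) + 1) * Δ)) := by
  refine ContinuousOn.congr (Continuous.continuousOn ?_) fun t ht => h.interpolation i hi t ht ω
  fun_prop

lemma exists_grid_lt_abs (h : IsDelayEM B Δ MT k A D α₃ Ξ X χ) {ω : Ω}
    (hB : Continuous fun t => B t ω) (hΔ : 0 < Δ) (hMT : 0 < MT) {lev t : ℝ}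
    (ht : t ∈ Set.Icc 0 ((MT : ℝ) * Δ)) (hlt : lev < |χ t ω|) :
    ∃ j : ℕ, ∃ n ≤ MT * 2 ^ j, lev < |χ (n * (Δ / 2 ^ j)) ω| := by
  obtain ⟨i, hi, hti⟩ := exists_mem_block hΔ hMT ht
  have hq : 0 ≤ t / Δ := div_nonneg ht.1 hΔ.le
  have hpow : Filter.Tendsto (fun j : ℕ => (2 : ℝ) ^ j) Filter.atTop Filter.atTop :=
    tendsto_pow_atTop_atTop_of_one_lt one_lt_two
  have hle : ∀ j : ℕ, (⌊t / Δ * 2 ^ j⌋₊ : ℝ) * (Δ / 2 ^ j) ≤ t := by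
    intro j
    calc (⌊t / Δ * 2 ^ j⌋₊ : ℝ) * (Δ / 2 ^ j) ≤ t / Δ * 2 ^ j * (Δ / 2 ^ j) := by
          gcongr
          exact Nat.floor_le (by positivity)
      _ = t := by field_simp
  have hlim : Filter.Tendsto (fun j : ℕ => (⌊t / Δ * 2 ^ j⌋₊ : ℝ) * (Δ / 2 ^ j))
      Filter.atTop (nhdsWithin t (Set.Icc ((i : ℝ) * Δ) (((i : ℝ) + 1) * Δ))) := by
    refine tendsto_nhdsWithin_iff.2 ⟨?_, Filter.Eventually.of_forall fun j => ⟨?_, ?_⟩⟩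
    · have h1 := ((tendsto_nat_floor_mul_div_atTop hq).comp hpow).mul_const Δ
      rw [div_mul_cancel₀ _ hΔ.ne'] at h1
      refine h1.congr fun j => ?_
      simp only [Function.comp_apply]
      ring
    · have h2 : i * 2 ^ j ≤ ⌊t / Δ * 2 ^ j⌋₊ := by
        refine Nat.le_floor ?_
        push_cast
        gcongr
        exact (le_div_iff₀ hΔ).2 hti.1
      calc (i : ℝ) * Δ = ((i * 2 ^ j : ℕ) : ℝ) * (Δ / 2 ^ j) := by push_cast; field_simp
        _ ≤ _ := by gcongr
    · exact (hle j).trans hti.2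
  have hχ := ((h.continuousOn_block hB hi t hti).tendsto.comp hlim).abs
  obtain ⟨j, hj⟩ := (hχ.eventually (lt_mem_nhds hlt)).exists
  refine ⟨j, ⌊t / Δ * 2 ^ j⌋₊, ?_, hj⟩
  refine Nat.floor_le_of_le ?_
  push_cast
  gcongr
  exact (div_le_iff₀ hΔ).2 ht.2

variable [MeasurableSpace Ω] {μ : Measure Ω} [IsProbabilityMeasure μ] {m : ℕ} {G L c₁ c₃ : ℝ}

/-- Weak-type bound for the running maximum of the continuous version of the scheme. -/
lemma measure_exists_lt_abs_le (h : IsDelayEM B Δ MT k A D α₃ Ξ X χ) (hB : IsBrownianPath μ B)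
    (hC : IsTamedCoeff m G Δ L c₁ c₃ A D α₃) (hm : 1 ≤ m) (hΔ : 0 < Δ) (hΔ1 : Δ ≤ 1)
    (hMT : 0 < MT) (hL : 0 ≤ L) (hc₁ : 0 ≤ c₁) (hc₃ : 0 ≤ c₃) {lev : ℝ} (hlev : 0 < lev) :
    μ {ω | ∃ t ∈ Set.Icc 0 ((MT : ℝ) * Δ), lev < |χ t ω|}
      ≤ ENNReal.ofReal (maximalConstant r m L c₁ c₃ Ξ (MT * Δ) / lev ^ (2 * m)) := by
  set E : ℕ → Set Ω := fun j => {ω | ∃ n ≤ MT * 2 ^ j, lev ≤ |χ (n * (Δ / 2 ^ j)) ω|} with hE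
  have hsub : {ω | ∃ t ∈ Set.Icc 0 ((MT : ℝ) * Δ), lev < |χ t ω|} ⊆ ⋃ j, E j := by
    rintro ω ⟨t, ht, hlt⟩
    obtain ⟨j, n, hn, hj⟩ := h.exists_grid_lt_abs (hB.continuous ω) hΔ hMT ht hlt
    exact Set.mem_iUnion.2 ⟨j, n, hn, hj.le⟩
  have hmono : Monotone E := by
    refine monotone_nat_of_le_succ fun j => ?_
    rintro ω ⟨n, hn, hlt⟩
    refine ⟨n * 2, by rw [pow_succ, ← mul_assoc]; exact Nat.mul_le_mul_right 2 hn, ?_⟩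
    have : ((n * 2 : ℕ) : ℝ) * (Δ / 2 ^ (j + 1)) = n * (Δ / 2 ^ j) := by
      push_cast; field_simp; ring
    rwa [this]
  have hΞ : ∀ ω, |χ 0 ω| ≤ Ξ := by
    intro ω
    have h0 := h.eq_scheme hΔ.le hMT ω
    obtain ⟨x, hx, hX⟩ := h.history 0 (Or.inl rfl) le_rfl
    rw [Nat.cast_zero, zero_mul, Nat.cast_zero, hX] at h0
    rwa [h0]
  have hM : 0 ≤ ∫ z, z ^ (2 * m) ∂(gaussianReal 0 1) :=
    integral_nonneg fun z => by simp only [Pi.zero_apply]; rw [pow_mul]; positivity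
  refine (measure_mono hsub).trans ?_
  rw [hmono.measure_iUnion]
  refine iSup_le fun j => ?_
  have hscheme := h.isDissipativeScheme (δ := Δ / 2 ^ j) hB hC hΔ hΔ1 hMT hL hc₁ hc₃
    (K := 2 ^ j) (by positivity) (by push_cast; field_simp)
  have hδ1 : Δ / 2 ^ j ≤ 1 := (div_le_self hΔ.le (one_le_pow₀ one_le_two)).trans hΔ1
  have hc : 0 ≤ schemeConstant r L c₁ c₃ Ξ := by unfold schemeConstant; positivity
  have hmain := hscheme.measure_exists_le_abs_le hm hL hc (by positivity) (by positivity) hδ1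
    (T := MT * Δ) (y₀ := Ξ) (by push_cast; exact le_of_eq (by field_simp))
    (fun ω => by simpa using hΞ ω) hlev
  simpa only [maximalConstant, Fintype.card_option, Fintype.card_fin] using hmain

end IsDelayEM

/-- A random variable with a weak-type tail of order `q > 1` has a bounded expectation. -/
lemma integral_le_of_measure_lt_le {Ω : Type*} [MeasurableSpace Ω] {μ : Measure Ω}
    [IsProbabilityMeasure μ] {f : Ω → ℝ} (hf : ∀ ω, 0 ≤ f ω) {C q : ℝ} (hC : 0 ≤ C) (hq : 1 < q)
    (htail : ∀ t, 0 < t → μ.real {ω | t < f ω} ≤ C * t ^ (-q)) :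
    ∫ ω, f ω ∂μ ≤ 1 + C / (q - 1) := by
  by_cases hi : Integrable f μ
  swap
  · rw [integral_undef hi]
    have : 0 < q - 1 := by linarith
    positivity
  rw [hi.integral_eq_integral_meas_lt (Filter.Eventually.of_forall hf)]
  have hsplit : Set.Ioc (0 : ℝ) 1 ∪ Set.Ioi 1 = Set.Ioi 0 := Set.Ioc_union_Ioi_eq_Ioi zero_le_one
  have htaili : IntegrableOn (fun t : ℝ => C * t ^ (-q)) (Set.Ioi 1) :=
    (integrableOn_Ioi_rpow_of_lt (by linarith) one_pos).const_mul C
  have hmeas : Measurable fun t : ℝ => μ.real {ω | t < f ω} := by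
    have : Antitone fun t : ℝ => μ.real {ω | t < f ω} := fun s t hst =>
      measureReal_mono fun ω hω => lt_of_le_of_lt hst hω
    exact this.measurable
  have hi0 : IntegrableOn (fun t : ℝ => μ.real {ω | t < f ω}) (Set.Ioc 0 1) := by
    refine Measure.integrableOn_of_bounded (M := 1) (by simp) hmeas.aestronglyMeasurable ?_
    refine Filter.Eventually.of_forall fun t => ?_
    rw [Real.norm_eq_abs, abs_of_nonneg measureReal_nonneg]
    exact measureReal_le_one
  have hle1 : ∀ t ∈ Set.Ioi (1 : ℝ), μ.real {ω | t < f ω} ≤ C * t ^ (-q) :=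
    fun t ht => htail t (one_pos.trans ht)
  have hi1 : IntegrableOn (fun t : ℝ => μ.real {ω | t < f ω}) (Set.Ioi 1) := by
    refine htaili.mono' hmeas.aestronglyMeasurable ?_
    refine (ae_restrict_iff' measurableSet_Ioi).2 (Filter.Eventually.of_forall fun t ht => ?_)
    rw [Real.norm_eq_abs, abs_of_nonneg measureReal_nonneg]
    exact hle1 t ht
  rw [← hsplit, setIntegral_union (Set.Ioc_disjoint_Ioi le_rfl) measurableSet_Ioi hi0 hi1]
  refine add_le_add ?_ ?_
  · calc ∫ t in Set.Ioc (0 : ℝ) 1, μ.real {ω | t < f ω}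
        ≤ ∫ _t in Set.Ioc (0 : ℝ) 1, (1 : ℝ) :=
          setIntegral_mono hi0 (integrable_const _) fun t => measureReal_le_one
      _ = 1 := by simp
  · calc ∫ t in Set.Ioi (1 : ℝ), μ.real {ω | t < f ω}
        ≤ ∫ t in Set.Ioi (1 : ℝ), C * t ^ (-q) :=
          setIntegral_mono_on hi1 htaili measurableSet_Ioi hle1
      _ = C / (q - 1) := by
          rw [integral_const_mul, integral_Ioi_rpow_of_lt (by linarith) one_pos, Real.one_rpow]
          have : q - 1 ≠ 0 := by linarith
          have : -q + 1 ≠ 0 := by linarith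
          field_simp
          ring

lemma continuous_of_abs_sub_le_rpow {f : ℝ → ℝ} {L l s : ℝ} (hl : 0 ≤ l) (hs : 0 < s)
    (hf : ∀ x y : ℝ, |f x - f y| ≤ L * (1 + |x| ^ l + |y| ^ l) * |x - y| ^ s) :
    Continuous f := by
  refine continuous_iff_continuousAt.2 fun y => tendsto_iff_dist_tendsto_zero.2 ?_
  have hlim : Filter.Tendsto (fun x => L * (1 + |x| ^ l + |y| ^ l) * |x - y| ^ s)
      (nhds y) (nhds 0) := by
    have hc : Continuous fun x : ℝ => L * (1 + |x| ^ l + |y| ^ l) * |x - y| ^ s := by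
      refine (continuous_const.mul ((continuous_const.add ?_).add continuous_const)).mul ?_
      · exact continuous_abs.rpow_const fun _ => Or.inr hl
      · exact (continuous_id.sub continuous_const).abs.rpow_const fun _ => Or.inr hs.le
    simpa [Real.zero_rpow hs.ne'] using hc.tendsto y
  exact squeeze_zero (fun _ => dist_nonneg) (fun x => hf x y) hlim

lemma continuous_of_abs_sub_le_sum {r : ℕ} {f : (Fin r → ℝ) → ℝ} {L : ℝ}
    (hf : ∀ x y, |f x - f y| ≤ L * ∑ i, |x i - y i|) : Continuous f := by
  refine continuous_iff_continuousAt.2 fun y => tendsto_iff_dist_tendsto_zero.2 ?_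
  have hlim : Filter.Tendsto (fun x : Fin r → ℝ => L * ∑ i, |x i - y i|) (nhds y) (nhds 0) := by
    have hc : Continuous fun x : Fin r → ℝ => L * ∑ i, |x i - y i| := by fun_prop
    simpa using hc.tendsto y
  exact squeeze_zero (fun _ => dist_nonneg) (fun x => hf x y) hlim

lemma sq_le_of_abs_sub_le_sum {r : ℕ} {f : (Fin r → ℝ) → ℝ} {L : ℝ}
    (hf : ∀ x y, |f x - f y| ≤ L * ∑ i, |x i - y i|) (x : Fin r → ℝ) :
    f x ^ 2 ≤ (2 * f 0 ^ 2 + 2 * L ^ 2 * r) * (1 + ∑ i, x i ^ 2) := by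
  have h1 := hf x 0
  simp only [Pi.zero_apply, sub_zero] at h1
  have h2 : (f x - f 0) ^ 2 ≤ L ^ 2 * (∑ i, |x i|) ^ 2 := by
    rw [← sq_abs, ← mul_pow]
    exact pow_le_pow_left₀ (abs_nonneg _) h1 2
  have h3 : (∑ i, |x i|) ^ 2 ≤ r * ∑ i, x i ^ 2 := by
    simpa using sq_sum_le_card_mul_sum_sq (s := Finset.univ) (f := fun i => |x i|)
  have h4 : L ^ 2 * (∑ i, |x i|) ^ 2 ≤ L ^ 2 * (r * ∑ i, x i ^ 2) := by gcongr
  have hS : 0 ≤ ∑ i, x i ^ 2 := Finset.sum_nonneg fun i _ => sq_nonneg _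
  have h5 : 0 ≤ 2 * f 0 ^ 2 * (∑ i, x i ^ 2) + 2 * L ^ 2 * r := by positivity
  linarith only [sq_nonneg (f x - 2 * f 0), h2, h4, h5]

/-- Truncation of `x` at modulus `M` is a contraction towards the origin. -/
lemma exists_factor_of_truncation {M x p : ℝ} (hM : 1 ≤ M)
    (hp : p = if x = 0 then 0 else min |x| M * (x / |x|)) :
    |p| ≤ M ∧ ∃ q, 1 ≤ q ∧ x = q * p ∧ q * (1 + p ^ 2) ≤ 2 * (1 + x ^ 2) := by
  rcases eq_or_ne x 0 with hx | hx
  · rw [if_pos hx] at hp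
    subst hp hx
    exact ⟨by simpa using zero_le_one.trans hM, 1, le_rfl, by simp, by norm_num⟩
  rw [if_neg hx] at hp
  have hx0 : 0 < |x| := abs_pos.2 hx
  have hM0 : 0 < M := one_pos.trans_le hM
  have habs : |p| = min |x| M := by
    rw [hp, abs_mul, abs_div, abs_abs, div_self hx0.ne', mul_one,
      abs_of_pos (lt_min hx0 hM0)]
  refine ⟨habs ▸ min_le_right _ _, ?_⟩
  rcases le_total |x| M with hle | hle
  · rw [min_eq_left hle, mul_div_cancel₀ _ hx0.ne'] at hp
    exact ⟨1, le_rfl, by rw [hp, one_mul], by rw [hp]; nlinarith [sq_nonneg x]⟩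
  · rw [min_eq_right hle] at hp habs
    refine ⟨|x| / M, (one_le_div hM0).2 hle, ?_, ?_⟩
    · rw [hp]; field_simp
    · have hpM : p ^ 2 = M ^ 2 := by rw [← sq_abs, habs]
      have h1 : |x| / M ≤ |x| := div_le_self hx0.le hM
      have h2 : |x| / M * M ^ 2 = |x| * M := by field_simp
      have h3 : |x| * M ≤ |x| * |x| := by gcongr
      rw [hpM, mul_add, mul_one, h2]
      nlinarith [sq_abs x, sq_nonneg (|x| - 1)]

lemma khasminskii_of_truncation {A b C x p q d d' : ℝ} (hq : 1 ≤ q) (hx : x = q * p)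
    (hqp : q * (1 + p ^ 2) ≤ 2 * (1 + x ^ 2)) (hC : 0 ≤ C) (hd : d' ≤ d) (hd' : 0 ≤ d)
    (hk : p * A + d / 2 * b ^ 2 ≤ C * (1 + p ^ 2)) :
    2 * x * A + d' * b ^ 2 ≤ 4 * C * (1 + x ^ 2) := by
  have h1 : d' * b ^ 2 ≤ d * b ^ 2 := by gcongr
  have h2 : 0 ≤ (q - 1) * (d * b ^ 2) := mul_nonneg (sub_nonneg.2 hq) (by positivity)
  have h3 := mul_le_mul_of_nonneg_left hk (show 0 ≤ 2 * q by linarith)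
  have h4 := mul_le_mul_of_nonneg_left hqp (show 0 ≤ 2 * C by linarith)
  have h5 : 2 * x * A = 2 * q * (p * A) := by rw [hx]; ring
  linarith only [h1, h2, h3, h4, h5]

/-- Uniform (in time) moment bound for the continuous truncated Euler–Maruyama
approximation (Lemma 3.4): under Assumptions A1–A4 and the conditions on `h`, `Γ`,
for every `p̄ ∈ (0, p̌/(l₃+1)]` there is a constant `C > 0`, independent of `Δ`,
such that `E[sup_{0≤t≤T} |χ(t)|^{p̄}] ≤ C` for all admissible `Δ ∈ (0,1]`. -/
theorem truncatedEM_sup_moment_bound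
    -- probability space and Brownian motion
    {Ω : Type*} [MeasurableSpace Ω] (μ : Measure Ω) [IsProbabilityMeasure μ]
    (B : ℝ → Ω → ℝ)
    (hB0 : ∀ᵐ ω ∂μ, B 0 ω = 0)
    (hBcont : ∀ ω, Continuous fun t => B t ω)
    (hBmeas : ∀ t, Measurable (B t))
    (hBgauss : ∀ s t : ℝ, 0 ≤ s → s ≤ t →
      Measure.map (fun ω => B t ω - B s ω) μ = gaussianReal 0 (Real.toNNReal (t - s)))
    (hBindep : ∀ s t : ℝ, 0 ≤ s → s ≤ t →
      IndepFun (fun ω => B t ω - B s ω) (fun ω (u : Set.Icc (0:ℝ) s) => B (u : ℝ) ω) μ)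
    -- coefficients
    (r : ℕ) (hr : 0 < r)
    (α₁ α₂ β : ℝ → ℝ) (α₃ : (Fin r → ℝ) → ℝ)
    -- Assumption A1
    (L₁ l₁ η : ℝ) (hL₁ : 0 < L₁) (hl₁ : 1 ≤ l₁) (hη : η ∈ Set.Ioo (0 : ℝ) 1)
    (hA1a : ∀ x y : ℝ, |α₁ x - α₁ y| ≤ L₁ * (1 + |x| ^ l₁ + |y| ^ l₁) * |x - y| ^ η)
    (hA1b : ∀ x y : ℝ, (x - y) * (α₂ x - α₂ y) ≤ L₁ * |x - y| ^ 2)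
    (hA1c : ∀ m n : Fin r → ℝ, |α₃ m - α₃ n| ≤ L₁ * ∑ i, |m i - n i|)
    (hα₁cont : Continuous α₁)
    (hα₁anti : ∀ x y : ℝ, x ≤ y → α₁ y ≤ α₁ x)
    -- Assumption A2
    (Lbar₂ pp : ℝ) (hLbar₂ : 0 < Lbar₂) (hpp : 2 ≤ pp)
    (hA2 : ∀ x : ℝ, x * (α₁ x + α₂ x) + (pp - 1) / 2 * |β x| ^ 2 ≤ Lbar₂ * (1 + x ^ 2))
    -- Assumption A3
    (L₃ σ l₂ l₃ : ℝ) (hL₃ : 0 < L₃) (hσ : σ ∈ Set.Ico (1/2 : ℝ) 1)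
    (hl₂ : 1 ≤ l₂) (hl₃ : 1 ≤ l₃)
    (hA3a : ∀ x y : ℝ, |α₂ x - α₂ y| ≤ L₃ * (1 + |x| ^ l₂ + |y| ^ l₂) * |x - y|)
    (hA3b : ∀ x y : ℝ, |β x - β y| ≤ L₃ * (1 + |x| ^ l₃ + |y| ^ l₃) * |x - y| ^ σ)
    -- delays and initial data (Assumption A4)
    (τ : Fin r → ℝ) (τmax : ℝ)
    (hτ0 : τ ⟨0, hr⟩ = 0) (hτmono : StrictMono τ)
    (hτtop : τ ⟨r - 1, by omega⟩ = τmax)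
    (ξ : ℝ → ℝ) (L₄ γ : ℝ) (hL₄ : 0 < L₄) (hγ : γ ∈ Set.Ioc (0 : ℝ) 1)
    (hA4 : ∀ s ∈ Set.Icc (-τmax) (0:ℝ), ∀ t ∈ Set.Icc (-τmax) (0:ℝ),
      |ξ t - ξ s| ≤ L₄ * |t - s| ^ γ)
    -- truncation data
    (h : ℝ → ℝ)
    (hmono : StrictMonoOn h (Set.Ioi (0 : ℝ)))
    (hcont : ContinuousOn h (Set.Ioi (0 : ℝ)))
    (htop : Filter.Tendsto h Filter.atTop Filter.atTop)
    (hbound : ∀ w : ℝ, 1 ≤ w → ∀ x : ℝ, |x| ≤ w →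
      max (max |α₁ x| |α₂ x|) |β x| ≤ h w)
    (hinv : ℝ → ℝ)
    (hinv_spec : ∀ y : ℝ, h 1 ≤ y → 1 ≤ hinv y ∧ h (hinv y) = y)
    (Γ : ℝ → ℝ) (L₀ : ℝ)
    (hΓanti : StrictAntiOn Γ (Set.Ioc (0 : ℝ) 1))
    (hΓtop : Filter.Tendsto Γ (nhdsWithin 0 (Set.Ioi (0:ℝ))) Filter.atTop)
    (hΓle : ∀ Δ ∈ Set.Ioc (0 : ℝ) 1, Δ ^ ((1:ℝ)/4) * Γ Δ ≤ L₀)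
    (hΓge : ∀ Δ ∈ Set.Ioc (0 : ℝ) 1, h 1 ≤ Γ Δ)
    (π : ℝ → ℝ → ℝ)
    (hπ : ∀ Δ x : ℝ, π Δ x =
      if x = 0 then 0 else min |x| (hinv (Γ Δ)) * (x / |x|))
    -- horizon and exponent
    (T : ℝ) (hT : 0 < T)
    (pbar : ℝ) (hpbar : pbar ∈ Set.Ioc (0 : ℝ) (pp / (l₃ + 1))) :
    ∃ C > (0 : ℝ),
      ∀ Δ ∈ Set.Ioc (0 : ℝ) 1, ∀ MT : ℕ, 0 < MT → Δ = T / MT →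
      ∀ k : Fin r → ℕ, (∀ v : Fin r, τ v = (k v : ℝ) * Δ) →
      ∀ X : ℤ → Ω → ℝ, ∀ χ : ℝ → Ω → ℝ,
        -- initial values of the scheme
        (∀ j : ℤ, -((k ⟨r - 1, by omega⟩ : ℕ) : ℤ) ≤ j → j ≤ 0 →
          ∀ ω, X j ω = ξ ((j : ℝ) * Δ)) →
        -- discrete truncated EM recursion
        (∀ j : ℕ, j < MT → ∀ ω, X ((j : ℤ) + 1) ω =
          X (j : ℤ) ω
            + (α₁ (π Δ (X (j : ℤ) ω)) + α₂ (π Δ (X (j : ℤ) ω))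
                + α₃ (fun v => X ((j : ℤ) - (k v : ℤ)) ω)) * Δ
            + β (π Δ (X (j : ℤ) ω)) * (B (((j : ℝ) + 1) * Δ) ω - B ((j : ℝ) * Δ) ω)) →
        -- continuous version of the scheme
        (∀ j : ℕ, j < MT → ∀ t ∈ Set.Icc ((j : ℝ) * Δ) (((j : ℝ) + 1) * Δ), ∀ ω,
          χ t ω = X (j : ℤ) ω
            + (α₁ (π Δ (X (j : ℤ) ω)) + α₂ (π Δ (X (j : ℤ) ω))
                + α₃ (fun v => X ((j : ℤ) - (k v : ℤ)) ω)) * (t - (j : ℝ) * Δ)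
            + β (π Δ (X (j : ℤ) ω)) * (B t ω - B ((j : ℝ) * Δ) ω)) →
        (∫ ω, (⨆ t : Set.Icc (0 : ℝ) T, |χ (t : ℝ) ω| ^ pbar) ∂μ) ≤ C := by
  have hpbar0 : 0 < pbar := hpbar.1
  obtain ⟨m, hm1, hm2, hm3⟩ : ∃ m : ℕ, 1 ≤ m ∧ 2 * (m : ℝ) ≤ pp ∧ pbar < 2 * (m : ℝ) := by
    have h1 : 1 ≤ ⌊pp / 2⌋₊ := Nat.le_floor (by push_cast; linarith)
    have h1' : (1 : ℝ) ≤ ⌊pp / 2⌋₊ := by exact_mod_cast h1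
    have h2 : (⌊pp / 2⌋₊ : ℝ) ≤ pp / 2 := Nat.floor_le (by linarith)
    have h3 : pp / 2 < ⌊pp / 2⌋₊ + 1 := Nat.lt_floor_add_one _
    have h4 : pp / (l₃ + 1) ≤ pp / 2 := by gcongr; linarith
    exact ⟨⌊pp / 2⌋₊, h1, by linarith, by linarith [hpbar.2]⟩
  have hBM : IsBrownianPath μ B := ⟨hBcont, hBmeas, hBgauss, hBindep⟩
  have hα₂m : Measurable α₂ := (continuous_of_abs_sub_le_rpow (s := 1) (zero_le_one.trans hl₂)
    one_pos (by simpa only [Real.rpow_one] using hA3a)).measurable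
  have hβm : Measurable β := (continuous_of_abs_sub_le_rpow (zero_le_one.trans hl₃)
    (by linarith [hσ.1]) hA3b).measurable
  have hα₃m : Measurable α₃ := (continuous_of_abs_sub_le_sum hA1c).measurable
  have hh1 : 0 ≤ h 1 :=
    (abs_nonneg (β 0)).trans ((le_max_right _ _).trans (hbound 1 le_rfl 0 (by simp)))
  set c₁ := 4 * Lbar₂ with hc₁
  set c₃ := 2 * α₃ 0 ^ 2 + 2 * L₁ ^ 2 * r with hc₃
  set L := L₀ ^ 4 with hL
  set Ξ := |ξ 0| + L₄ * τmax ^ γ with hΞ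
  set Cmax := maximalConstant r m L c₁ c₃ Ξ T with hCmax
  have hCmax0 : 0 ≤ Cmax := maximalConstant_nonneg _ _ _ _ _ _ _
  have hq : 1 < 2 * (m : ℝ) / pbar := (one_lt_div hpbar0).2 hm3
  refine ⟨1 + Cmax / (2 * (m : ℝ) / pbar - 1),
    by have : 0 < 2 * (m : ℝ) / pbar - 1 := sub_pos.2 hq
       positivity, ?_⟩
  intro Δ hΔ MT hMT hΔT k hk X χ hist hrec hint
  have hMTR : (0 : ℝ) < MT := by exact_mod_cast hMT
  have hTΔ : (MT : ℝ) * Δ = T := by rw [hΔT]; field_simp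
  have hcoeff : IsTamedCoeff m (Γ Δ) Δ L c₁ c₃
      (fun x => α₁ (π Δ x) + α₂ (π Δ x)) (fun x => β (π Δ x)) α₃ := by
    obtain ⟨hM1, hM2⟩ := hinv_spec (Γ Δ) (hΓge Δ hΔ)
    have htr := fun x => exists_factor_of_truncation hM1 (hπ Δ x)
    have hb := fun x => hbound _ hM1 _ (htr x).1
    rw [hM2] at hb
    have hπm : Measurable (π Δ) := by
      rw [funext (hπ Δ)]
      exact Measurable.ite (measurableSet_singleton 0) measurable_const
        ((measurable_norm.min measurable_const).mul (measurable_id.div measurable_norm))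
    have hΓ0 : 0 ≤ Γ Δ := hh1.trans (hΓge Δ hΔ)
    refine
      { measurable_drift := (hα₁cont.measurable.comp hπm).add (hα₂m.comp hπm)
        measurable_diffusion := hβm.comp hπm
        measurable_delay := hα₃m
        abs_drift_le := fun x => ?_
        abs_diffusion_le := fun x => (le_max_right _ _).trans (hb x)
        size_le := ?_
        khasminskii := fun x => ?_
        delay_sq_le := sq_le_of_abs_sub_le_sum hA1c }
    · have h1 := (le_max_left _ _).trans ((le_max_left _ _).trans (hb x))
      have h2 := (le_max_right _ _).trans ((le_max_left _ _).trans (hb x))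
      exact (abs_add_le _ _).trans (by linarith)
    · have h1 : (Δ ^ ((1 : ℝ) / 4)) ^ 4 = Δ := by
        rw [← Real.rpow_natCast, ← Real.rpow_mul hΔ.1.le]
        norm_num
      have h2 : (Δ ^ ((1 : ℝ) / 4) * Γ Δ) ^ 4 ≤ L₀ ^ 4 :=
        pow_le_pow_left₀ (mul_nonneg (Real.rpow_nonneg hΔ.1.le _) hΓ0) (hΓle Δ hΔ) 4
      rwa [mul_pow, h1, mul_comm] at h2
    · obtain ⟨q, hq1, hxq, hqp⟩ := (htr x).2
      refine khasminskii_of_truncation (d := pp - 1) hq1 hxq hqp hLbar₂.le (by linarith)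
        (by linarith) ?_
      simpa only [sq_abs] using hA2 (π Δ x)
  have hhist : ∀ j : ℤ, (j = 0 ∨ ∃ v, -(k v : ℤ) ≤ j) → j ≤ 0 →
      ∃ x, |x| ≤ Ξ ∧ ∀ ω, X j ω = x := by
    intro j hj hj0
    have hlast : ∀ v, k v ≤ k ⟨r - 1, by omega⟩ := by
      intro v
      have h1 : τ v ≤ τ ⟨r - 1, by omega⟩ :=
        hτmono.monotone (Fin.le_def.2 (by simp only; omega))
      rw [hk, hk] at h1
      exact_mod_cast le_of_mul_le_mul_right h1 hΔ.1
    have hjk : -((k ⟨r - 1, by omega⟩ : ℕ) : ℤ) ≤ j := by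
      rcases hj with rfl | ⟨v, hv⟩
      · omega
      · have := hlast v
        omega
    refine ⟨ξ (j * Δ), ?_, hist j hjk hj0⟩
    have hj0' : (j : ℝ) * Δ ≤ 0 :=
      mul_nonpos_of_nonpos_of_nonneg (by exact_mod_cast hj0) hΔ.1.le
    have hjτ : -τmax ≤ (j : ℝ) * Δ := by
      rw [← hτtop, hk, ← neg_mul]
      have : (-((k ⟨r - 1, by omega⟩ : ℕ) : ℝ)) ≤ (j : ℝ) := by exact_mod_cast hjk
      exact mul_le_mul_of_nonneg_right this hΔ.1.le
    have h1 := hA4 0 ⟨by linarith, le_rfl⟩ (j * Δ) ⟨hjτ, hj0'⟩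
    have h2 : |(j : ℝ) * Δ - 0| ^ γ ≤ τmax ^ γ := by
      refine Real.rpow_le_rpow (abs_nonneg _) ?_ hγ.1.le
      rw [sub_zero, abs_of_nonpos hj0']
      linarith
    calc |ξ (j * Δ)| = |ξ 0 + (ξ (j * Δ) - ξ 0)| := by ring_nf
      _ ≤ |ξ 0| + |ξ (j * Δ) - ξ 0| := abs_add_le _ _
      _ ≤ |ξ 0| + L₄ * τmax ^ γ := by gcongr; exact h1.trans (by gcongr)
  have hEM : IsDelayEM B Δ MT k (fun x => α₁ (π Δ x) + α₂ (π Δ x)) (fun x => β (π Δ x)) α₃ Ξ X χ :=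
    ⟨hhist, hrec, hint⟩
  have hnonempty : Nonempty (Set.Icc (0 : ℝ) T) := ⟨⟨0, le_rfl, hT.le⟩⟩
  refine integral_le_of_measure_lt_le
    (fun ω => Real.iSup_nonneg fun t => Real.rpow_nonneg (abs_nonneg _) _) hCmax0 hq ?_
  intro t ht
  have hlev : 0 < t ^ pbar⁻¹ := Real.rpow_pos_of_pos ht _
  have hsub : {ω | t < ⨆ s : Set.Icc (0 : ℝ) T, |χ (s : ℝ) ω| ^ pbar}
      ⊆ {ω | ∃ s ∈ Set.Icc 0 ((MT : ℝ) * Δ), t ^ pbar⁻¹ < |χ s ω|} := by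
    intro ω hω
    obtain ⟨s, hs⟩ := exists_lt_of_lt_ciSup (show t < _ from hω)
    refine ⟨s, by rw [hTΔ]; exact s.2, ?_⟩
    exact (Real.rpow_inv_lt_iff_of_pos ht.le (abs_nonneg _) hpbar0).2 hs
  have hmain := hEM.measure_exists_lt_abs_le hBM hcoeff hm1 hΔ.1 hΔ.2 hMT (by positivity)
    (by positivity) (by positivity) hlev
  rw [hTΔ] at hmain
  have hpow : (t ^ pbar⁻¹) ^ (2 * m) = t ^ (2 * (m : ℝ) / pbar) := by
    rw [← Real.rpow_natCast, ← Real.rpow_mul ht.le]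
    congr 1
    push_cast
    field_simp
  rw [hpow, div_eq_mul_inv, ← Real.rpow_neg ht.le] at hmain
  rw [measureReal_def]
  exact ENNReal.toReal_le_of_le_ofReal (by positivity)
    ((measure_mono (by rw [hTΔ] at hsub; exact hsub)).trans hmain)
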